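/- arXiv:2603.29277 — 7 statements merged into one kernel-verified Lean document; each statement's English description precedes it below -/
import Mathlib

section
/- Let r ≥ 3 and let (G,f) be a q-edge-colored graph with minimum degree δ(G) ≥ ((r−1)/r)·|V(G)| + 3 which contains no K_r-template. Then there is a subset U ⊆ V(G) with |U| ≥ δ(G) such that the edges of the induced subgraph G[U] receive at most C(r,2) = r(r−1)/2 different colors. -/
open Finset

variable {V : Type*}

/-- A `Kᵣ`-tiling of the vertex set `W`: a collection of pairwise-disjoint `r`-cliques of `G`
whose union is `W`. -/
def IsKrTilingOn [DecidableEq V] (G : SimpleGraph V) (r : ℕ)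
    (T : Finset (Finset V)) (W : Finset V) : Prop :=
  (∀ K ∈ T, G.IsNClique r K) ∧
  (∀ K ∈ T, ∀ K' ∈ T, K ≠ K' → Disjoint K K') ∧
  T.biUnion id = W

/-- A perfect `Kᵣ`-tiling of `G`. -/
def IsKrTiling [Fintype V] [DecidableEq V] (G : SimpleGraph V) (r : ℕ)
    (T : Finset (Finset V)) : Prop :=
  IsKrTilingOn G r T Finset.univ

/-- The number of edges of color `c` lying inside the cliques of `T`. -/
def tilingColorCount [DecidableEq V] {q : ℕ} (f : Sym2 V → Fin q)
    (T : Finset (Finset V)) (c : Fin q) : ℕ :=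
  ∑ K ∈ T, (K.sym2.filter fun e => ¬ e.IsDiag ∧ f e = c).card

/-- The total number of edges lying inside the cliques of `T`. -/
def tilingEdgeCount [DecidableEq V] (T : Finset (Finset V)) : ℕ :=
  ∑ K ∈ T, (K.sym2.filter fun e => ¬ e.IsDiag).card


/-- `(G, f)` contains a `K_r`-template: a clique `K` of size `r − 2` together with an
unbalanced cycle of length `4` or `6` in the common neighborhood of `K`. -/
def HasKrTemplate {V : Type*} {q : ℕ} (G : SimpleGraph V) (f : Sym2 V → Fin q)
    (r : ℕ) : Prop :=
  ∃ (K : Finset V) (k : ℕ) (w : ℕ → V),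
    G.IsNClique (r - 2) K ∧ (k = 2 ∨ k = 3) ∧
    (∀ i < 2 * k, ∀ j < 2 * k, w i = w j → i = j) ∧
    (∀ i < 2 * k, ∀ x ∈ K, G.Adj x (w i)) ∧
    (∀ i < 2 * k, G.Adj (w i) (w ((i + 1) % (2 * k)))) ∧
    (↑((List.range k).map fun i => f s(w (2 * i), w (2 * i + 1))) : Multiset (Fin q)) ≠
      (↑((List.range k).map fun i =>
          f s(w (2 * i + 1), w ((2 * i + 2) % (2 * k)))) : Multiset (Fin q))


namespace FewColors

variable {W : Type} [DecidableEq W]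

/-- indicator vector of the color of an edge -/
def F {q : ℕ} (f : Sym2 W → Fin q) (u v : W) : Fin q → ℤ :=
  if u = v then 0 else Pi.single (f s(u, v)) 1

def dg {q : ℕ} (f : Sym2 W → Fin q) (Q : Finset W) (v : W) : Fin q → ℤ := ∑ w ∈ Q, F f v w

def S {q : ℕ} (f : Sym2 W → Fin q) (Q : Finset W) : Fin q → ℤ := ∑ v ∈ Q, dg f Q v

structure Hyp {q : ℕ} (G : SimpleGraph W) [DecidableRel G.Adj] (f : Sym2 W → Fin q)
    (X : Finset W) (r D : ℕ) : Prop where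
  nn : ∀ v ∈ X, (X.filter fun w => ¬ G.Adj v w).card ≤ D
  big : r * D < X.card
  E : ∀ R : Finset W, R ⊆ X → G.IsNClique (r - 1) R → ∀ u ∈ R, ∀ a ∈ X, ∀ b ∈ X, ∀ a' ∈ X, ∀ b' ∈ X,
    (∀ w ∈ R, G.Adj w a) → (∀ w ∈ R, G.Adj w b) → (∀ w ∈ R, G.Adj w a') → (∀ w ∈ R, G.Adj w b') →
    G.Adj a b → G.Adj a' b' →
    F f u a + F f u b + F f a' b' = F f u a' + F f u b' + F f a b

section basic
variable {q : ℕ} (f : Sym2 W → Fin q)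

lemma F_self (u : W) : F f u u = 0 := by simp [F]

lemma F_comm (u v : W) : F f u v = F f v u := by
  unfold F; by_cases h : u = v
  · simp [h]
  · simp [h, Ne.symm h, Sym2.eq_swap]

lemma F_ne {u v : W} (h : u ≠ v) : F f u v = Pi.single (f s(u, v)) 1 := by simp [F, h]

lemma F_nonneg (u v : W) (c : Fin q) : 0 ≤ F f u v c := by
  unfold F; split_ifs
  · simp
  · simp [Pi.single_apply]; split_ifs <;> simp

lemma F_sum {u v : W} (h : u ≠ v) : ∑ c, F f u v c = 1 := by
  simp [F_ne f h]

lemma dg_insert {Q : Finset W} {x : W} (hx : x ∉ Q) (v : W) :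
    dg f (insert x Q) v = F f v x + dg f Q v := by
  simp [dg, Finset.sum_insert hx]

lemma S_insert {Q : Finset W} {x : W} (hx : x ∉ Q) :
    S f (insert x Q) = S f Q + 2 • dg f Q x := by
  unfold S
  rw [Finset.sum_insert hx, dg_insert f hx, F_self]
  have : ∑ v ∈ Q, dg f (insert x Q) v = ∑ v ∈ Q, (F f x v + dg f Q v) :=
    Finset.sum_congr rfl fun v _ => by rw [dg_insert f hx, F_comm]
  rw [this, Finset.sum_add_distrib]
  have : ∑ v ∈ Q, F f x v = dg f Q x := rfl
  rw [this, two_nsmul]; abel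

lemma S_erase {Q : Finset W} {x : W} (hx : x ∈ Q) :
    S f Q = S f (Q.erase x) + 2 • dg f Q x := by
  have h := S_insert f (Finset.notMem_erase x Q)
  rw [Finset.insert_erase hx] at h
  rw [h]; congr 2
  have := dg_insert f (Finset.notMem_erase x Q) x
  rw [Finset.insert_erase hx, F_self] at this
  rw [this]; simp

lemma dg_erase (Q : Finset W) (x : W) : dg f (Q.erase x) x = dg f Q x := by
  by_cases hx : x ∈ Q
  · have := dg_insert f (Finset.notMem_erase x Q) x
    rw [Finset.insert_erase hx, F_self] at this
    rw [this]; simp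
  · rw [Finset.erase_eq_of_notMem hx]

lemma dg_nonneg (Q : Finset W) (v : W) (c : Fin q) : 0 ≤ dg f Q v c := by
  unfold dg; rw [Finset.sum_apply]; exact Finset.sum_nonneg fun w _ => F_nonneg f v w c

lemma dg_le_S (Q : Finset W) {v : W} (hv : v ∈ Q) (c : Fin q) : dg f Q v c ≤ S f Q c := by
  unfold S; rw [Finset.sum_apply]
  exact Finset.single_le_sum (f := fun v => dg f Q v c) (fun w _ => dg_nonneg f Q w c) hv

lemma S_nonneg (Q : Finset W) (c : Fin q) : 0 ≤ S f Q c := by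
  unfold S; rw [Finset.sum_apply]; exact Finset.sum_nonneg fun w _ => dg_nonneg f Q w c

lemma F_le_dg (Q : Finset W) (v : W) {w : W} (hw : w ∈ Q) (c : Fin q) :
    F f v w c ≤ dg f Q v c := by
  unfold dg; rw [Finset.sum_apply]
  exact Finset.single_le_sum (f := fun w => F f v w c) (fun w _ => F_nonneg f v w c) hw

lemma S_mono_even (Q : Finset W) (c : Fin q) : Even (S f Q c) := by
  induction Q using Finset.induction_on with
  | empty => simp [S]
  | insert x Q hx ih =>
    rw [S_insert f hx]
    simp only [Pi.add_apply, Pi.smul_apply]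
    exact ih.add (by simp [even_two_mul])

lemma dg_sum {Q : Finset W} {v : W} (hv : v ∉ Q) : ∑ c, dg f Q v c = Q.card := by
  unfold dg
  simp_rw [Finset.sum_apply]
  rw [Finset.sum_comm, Finset.sum_congr rfl (g := fun _ => (1 : ℤ))]
  · simp
  · intro w hw; exact F_sum f (by rintro rfl; exact hv hw)

lemma S_sum (Q : Finset W) : ∑ c, S f Q c = Q.card * (Q.card - 1 : ℤ) := by
  induction Q using Finset.induction_on with
  | empty => simp [S]
  | insert x Q hx ih =>
    rw [S_insert f hx]
    simp only [Pi.add_apply, Pi.smul_apply, Finset.sum_add_distrib, ih, Finset.card_insert_of_notMem hx,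
      ← Finset.smul_sum, dg_sum f hx]
    push_cast; simp; ring

lemma S_color {Q : Finset W} {u v : W} (hu : u ∈ Q) (hv : v ∈ Q) (h : u ≠ v) :
    2 ≤ S f Q (f s(u, v)) := by
  have h1 : 1 ≤ dg f Q u (f s(u, v)) := by
    have := F_le_dg f Q u hv (f s(u, v))
    rw [F_ne f h] at this; simpa using this
  rw [S_erase f hu]
  have := S_nonneg f (Q.erase u) (f s(u, v))
  simp; omega

end basic
end FewColors

namespace FewColors

variable {W : Type} [DecidableEq W] {q : ℕ} {G : SimpleGraph W} [DecidableRel G.Adj]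
  {f : Sym2 W → Fin q} {X : Finset W} {r D : ℕ}

/-- `(r+1)`-cliques inside `X` -/
def CQ (G : SimpleGraph W) (X : Finset W) (r : ℕ) (Q : Finset W) : Prop :=
  Q ⊆ X ∧ G.IsNClique (r + 1) Q

lemma isNClique_insert {n : ℕ} {T : Finset W} {z : W} (hT : G.IsNClique n T)
    (h : ∀ t ∈ T, G.Adj t z) : G.IsNClique (n + 1) (insert z T) := by
  apply hT.insert
  intro b hb; exact (h b hb).symm

lemma notMem_of_adj {T : Finset W} {z : W} (h : ∀ t ∈ T, G.Adj t z) : z ∉ T :=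
  fun hz => (h z hz).ne rfl

lemma Hyp.common (H : Hyp G f X r D) {T : Finset W} (hT : T ⊆ X) (hc : T.card ≤ r) :
    ∃ z ∈ X, ∀ t ∈ T, G.Adj t z := by
  by_contra hcon
  push Not at hcon
  have hsub : X ⊆ T.biUnion fun t => X.filter fun w => ¬ G.Adj t w := by
    intro z hz
    obtain ⟨t, ht, h⟩ := hcon z hz
    simp only [mem_biUnion, mem_filter]
    exact ⟨t, ht, hz, h⟩
  have h1 := card_le_card hsub
  have h2 : (T.biUnion fun t => X.filter fun w => ¬ G.Adj t w).card ≤ T.card * D :=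
    card_biUnion_le_card_mul _ _ _ fun t ht => H.nn t (hT ht)
  have h3 := Nat.mul_le_mul_right D hc
  have := H.big
  omega

lemma Hyp.extend (H : Hyp G f X r D) : ∀ k : ℕ, ∀ T : Finset W, T ⊆ X → ∀ n, G.IsNClique n T →
    n + k = r + 1 → ∃ Q, T ⊆ Q ∧ CQ G X r Q := by
  intro k
  induction k with
  | zero =>
    intro T hT n hc hn
    obtain rfl : n = r + 1 := by omega
    exact ⟨T, Subset.rfl, hT, hc⟩
  | succ k ih =>
    intro T hT n hc hn
    obtain ⟨z, hz, hza⟩ := H.common hT (by rw [hc.card_eq]; omega)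
    obtain ⟨Q, hQ, hQ'⟩ := ih (insert z T) (insert_subset hz hT) (n + 1) (isNClique_insert hc hza)
      (by omega)
    exact ⟨Q, (subset_insert _ _).trans hQ, hQ'⟩

lemma Hyp.extend' (H : Hyp G f X r D) {T : Finset W} (hT : T ⊆ X) {n : ℕ} (hc : G.IsNClique n T)
    (hn : n ≤ r + 1) : ∃ Q, T ⊆ Q ∧ CQ G X r Q :=
  H.extend (r + 1 - n) T hT n hc (by omega)

lemma Hyp.descend (H : Hyp G f X r D) (hr : 2 ≤ r) {z : W} (hz : z ∈ X) :
    Hyp G f (X.filter (G.Adj z)) (r - 1) D where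
  nn v hv := by
    refine le_trans (card_le_card ?_) (H.nn v (mem_filter.1 hv).1)
    exact filter_subset_filter _ (filter_subset _ _)
  big := by
    have h1 := card_filter_add_card_filter_not (s := X) (G.Adj z)
    have h2 := H.nn z hz
    have h3 := H.big
    obtain ⟨s, rfl⟩ : ∃ s, r = s + 1 := ⟨r - 1, by omega⟩
    simp only [Nat.add_sub_cancel]
    have : (s + 1) * D = s * D + D := by ring
    omega
  E R hR hRc u hu a ha b hb a' ha' b' hb' h1 h2 h3 h4 h5 h6 := by
    have hzR : ∀ w ∈ R, G.Adj w z := fun w hw => (mem_filter.1 (hR hw)).2.symm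
    refine H.E (insert z R) (insert_subset hz (hR.trans (filter_subset _ _))) ?_ u
      (mem_insert_of_mem hu) a (mem_filter.1 ha).1 b (mem_filter.1 hb).1 a' (mem_filter.1 ha').1
      b' (mem_filter.1 hb').1 ?_ ?_ ?_ ?_ h5 h6
    · have := isNClique_insert hRc hzR
      rwa [show r - 1 - 1 + 1 = r - 1 by omega] at this
    all_goals
      intro w hw
      rcases mem_insert.1 hw with rfl | hw
      · first
          | exact (mem_filter.1 ha).2
          | exact (mem_filter.1 hb).2
          | exact (mem_filter.1 ha').2
          | exact (mem_filter.1 hb').2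
      · solve_by_elim

lemma dg_two {R : Finset W} {a b : W} (ha : a ∉ R) (hb : b ∉ R) (hab : a ≠ b) (u : W) (c : Fin q) :
    dg f (insert a (insert b R)) u c = F f u a c + F f u b c + dg f R u c := by
  rw [dg_insert f (by simp [ha, hab]), dg_insert f hb]
  simp; ring

lemma S_two {R : Finset W} {a b : W} (ha : a ∉ R) (hb : b ∉ R) (hab : a ≠ b) (c : Fin q) :
    S f (insert a (insert b R)) c =
      S f R c + 2 * F f a b c + 2 * ∑ u ∈ R, (F f u a c + F f u b c) := by
  rw [S_insert f (by simp [ha, hab]), S_insert f hb, dg_insert f hb]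
  rw [sum_add_distrib]
  have h1 : dg f R a c = ∑ u ∈ R, F f u a c := by
    unfold dg; rw [Finset.sum_apply]; exact sum_congr rfl fun u _ => by rw [F_comm]
  have h2 : dg f R b c = ∑ u ∈ R, F f u b c := by
    unfold dg; rw [Finset.sum_apply]; exact sum_congr rfl fun u _ => by rw [F_comm]
  simp [← h1, ← h2]; ring

lemma Hyp.move (H : Hyp G f X r D) {R : Finset W} (hr : 1 ≤ r) (hR : R ⊆ X)
    (hRc : G.IsNClique (r - 1) R)
    {a b a' b' : W} (ha : a ∈ X) (hb : b ∈ X) (ha' : a' ∈ X) (hb' : b' ∈ X)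
    (h1 : ∀ w ∈ R, G.Adj w a) (h2 : ∀ w ∈ R, G.Adj w b) (h3 : ∀ w ∈ R, G.Adj w a')
    (h4 : ∀ w ∈ R, G.Adj w b') (h5 : G.Adj a b) (h6 : G.Adj a' b') {u : W} (hu : u ∈ R)
    (c : Fin q) :
    2 * (r : ℤ) * (dg f (insert a (insert b R)) u c - dg f (insert a' (insert b' R)) u c) =
      S f (insert a (insert b R)) c - S f (insert a' (insert b' R)) c := by
  have hE : ∀ u ∈ R, F f u a c + F f u b c = F f u a' c + F f u b' c + (F f a b c - F f a' b' c) := by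
    intro u hu
    have := congrFun (H.E R hR hRc u hu a ha b hb a' ha' b' hb' h1 h2 h3 h4 h5 h6) c
    simp only [Pi.add_apply] at this
    linarith
  rw [dg_two (notMem_of_adj h1) (notMem_of_adj h2) h5.ne,
    dg_two (notMem_of_adj h3) (notMem_of_adj h4) h6.ne,
    S_two (notMem_of_adj h1) (notMem_of_adj h2) h5.ne,
    S_two (notMem_of_adj h3) (notMem_of_adj h4) h6.ne, hE u hu, sum_congr rfl hE,
    sum_add_distrib]
  simp only [sum_const, hRc.card_eq, smul_eq_mul, nsmul_eq_mul]
  push_cast [hr]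
  ring

lemma CQ.adj {Q : Finset W} (h : CQ G X r Q) {u v : W} (hu : u ∈ Q) (hv : v ∈ Q) (huv : u ≠ v) :
    G.Adj u v := h.2.isClique hu hv huv

lemma CQ.sub {Q : Finset W} (h : CQ G X r Q) {T : Finset W} (hT : T ⊆ Q) :
    G.IsNClique T.card T := ⟨h.2.isClique.subset (by exact_mod_cast hT), rfl⟩

lemma Hyp.phi_aux (H : Hyp G f X r D) (hr : 2 ≤ r) (w : W) (c : Fin q) : ∀ k : ℕ, ∀ L : Finset W,
    w ∈ L → L.card + k = r - 1 → ∀ Q Q', CQ G X r Q → CQ G X r Q' → L ⊆ Q → L ⊆ Q' →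
    2 * (r : ℤ) * (dg f Q w c - dg f Q' w c) = S f Q c - S f Q' c := by
  intro k
  induction k with
  | zero =>
    intro L hwL hL Q Q' hQ hQ' hLQ hLQ'
    have key : ∀ Q, CQ G X r Q → L ⊆ Q → ∃ a ∈ X, ∃ b ∈ X, (∀ w ∈ L, G.Adj w a) ∧
        (∀ w ∈ L, G.Adj w b) ∧ G.Adj a b ∧ Q = insert a (insert b L) := by
      intro Q hQ hLQ
      have hc : (Q \ L).card = 2 := by
        rw [card_sdiff_of_subset hLQ, hQ.2.card_eq]; omega
      obtain ⟨a, b, hab, he⟩ := card_eq_two.1 hc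
      have ha : a ∈ Q \ L := by simp [he]
      have hb : b ∈ Q \ L := by simp [he]
      rw [mem_sdiff] at ha hb
      refine ⟨a, hQ.1 ha.1, b, hQ.1 hb.1, ?_, ?_, hQ.adj ha.1 hb.1 hab, ?_⟩
      · intro w hw; exact hQ.adj (hLQ hw) ha.1 (by rintro rfl; exact ha.2 hw)
      · intro w hw; exact hQ.adj (hLQ hw) hb.1 (by rintro rfl; exact hb.2 hw)
      · rw [← sdiff_union_of_subset hLQ, he]; ext; simp [or_assoc]
    obtain ⟨a, ha, b, hb, h1, h2, h3, rfl⟩ := key Q hQ hLQ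
    obtain ⟨a', ha', b', hb', h1', h2', h3', rfl⟩ := key Q' hQ' hLQ'
    have hLc : G.IsNClique (r - 1) L := by
      have := hQ.sub hLQ
      rwa [show L.card = r - 1 by omega] at this
    exact H.move (by omega) (hLQ.trans hQ.1) hLc ha hb ha' hb' h1 h2 h1' h2' h3 h3' hwL c
  | succ k ih =>
    intro L hwL hL Q Q' hQ hQ' hLQ hLQ'
    have key : ∀ Q, CQ G X r Q → L ⊆ Q → ∃ x ∈ Q, x ∉ L := by
      intro Q hQ hLQ
      by_contra hcon
      push Not at hcon
      have := card_le_card (show Q ⊆ L from hcon)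
      rw [hQ.2.card_eq] at this; omega
    obtain ⟨x, hxQ, hxL⟩ := key Q hQ hLQ
    obtain ⟨y, hyQ, hyL⟩ := key Q' hQ' hLQ'
    obtain ⟨z, hzX, hz⟩ := H.common (T := insert x (insert y L))
      (insert_subset (hQ.1 hxQ) (insert_subset (hQ'.1 hyQ) (hLQ.trans hQ.1)))
      (by have := card_insert_le x (insert y L); have := card_insert_le y L; omega)
    have hzL : ∀ t ∈ L, G.Adj t z := fun t ht => hz t (by simp [ht])
    have hzx : ∀ t ∈ insert x L, G.Adj t z := fun t ht => hz t (by
      simp only [mem_insert] at ht ⊢; tauto)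
    have hzy : ∀ t ∈ insert y L, G.Adj t z := fun t ht => hz t (by
      simp only [mem_insert] at ht ⊢; tauto)
    have hxLs : insert x L ⊆ Q := insert_subset hxQ hLQ
    have hyLs : insert y L ⊆ Q' := insert_subset hyQ hLQ'
    have cx := card_insert_of_notMem hxL
    have cy := card_insert_of_notMem hyL
    have cz := card_insert_of_notMem (notMem_of_adj hzL)
    obtain ⟨Q3, h3, hQ3⟩ := H.extend' (insert_subset hzX (hxLs.trans hQ.1))
      (isNClique_insert (hQ.sub hxLs) hzx) (by omega)
    obtain ⟨Q4, h4, hQ4⟩ := H.extend' (insert_subset hzX (hyLs.trans hQ'.1))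
      (isNClique_insert (hQ'.sub hyLs) hzy) (by omega)
    have e1 := ih (insert x L) (by simp [hwL]) (by omega) Q Q3 hQ hQ3 hxLs
      ((subset_insert _ _).trans h3)
    have e2 := ih (insert z L) (by simp [hwL]) (by omega) Q3 Q4 hQ3 hQ4
      ((insert_subset_insert _ (subset_insert _ _)).trans h3)
      ((insert_subset_insert _ (subset_insert _ _)).trans h4)
    have e3 := ih (insert y L) (by simp [hwL]) (by omega) Q4 Q' hQ4 hQ'
      ((subset_insert _ _).trans h4) hyLs
    linarith

lemma Hyp.phi (H : Hyp G f X r D) (hr : 2 ≤ r) {w : W} {Q Q' : Finset W} (hQ : CQ G X r Q)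
    (hQ' : CQ G X r Q') (hw : w ∈ Q) (hw' : w ∈ Q') (c : Fin q) :
    2 * (r : ℤ) * (dg f Q w c - dg f Q' w c) = S f Q c - S f Q' c :=
  H.phi_aux hr w c (r - 2) {w} (by simp) (by simp; omega) Q Q' hQ hQ' (by simpa using hw)
    (by simpa using hw')

lemma CQ.nonempty {Q : Finset W} (h : CQ G X r Q) : Q.Nonempty := by
  rw [← card_pos, h.2.card_eq]; omega

/-- a common neighbor of two vertices, together with cliques through it and each of them -/
lemma Hyp.link (H : Hyp G f X r D) (hr : 2 ≤ r) {v v' : W} (hv : v ∈ X) (hv' : v' ∈ X) :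
    ∃ y ∈ X, ∃ Q3 Q4, CQ G X r Q3 ∧ CQ G X r Q4 ∧ v ∈ Q3 ∧ y ∈ Q3 ∧ y ∈ Q4 ∧ v' ∈ Q4 ∧ G.Adj v y ∧
      G.Adj v' y := by
  obtain ⟨y, hy, hya⟩ := H.common (T := {v, v'}) (by simp [insert_subset_iff, hv, hv'])
    (card_le_two.trans hr)
  have key : ∀ v ∈ X, G.Adj v y → ∃ Q, CQ G X r Q ∧ v ∈ Q ∧ y ∈ Q := by
    intro v hv hvy
    have : G.IsNClique (1 + 1) (insert y {v}) := isNClique_insert (by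
      simp [SimpleGraph.isNClique_iff]) (by simpa using hvy)
    obtain ⟨Q, hQ, hQ'⟩ := H.extend' (insert_subset hy (singleton_subset_iff.2 hv)) this (by omega)
    exact ⟨Q, hQ', hQ (by simp), hQ (by simp)⟩
  have a1 := hya v (by simp)
  have a2 := hya v' (by simp)
  obtain ⟨Q3, h3, h3v, h3y⟩ := key v hv a1
  obtain ⟨Q4, h4, h4v, h4y⟩ := key v' hv' a2
  exact ⟨y, hy, Q3, Q4, h3, h4, h3v, h3y, h4y, h4v, a1, a2⟩

lemma Hyp.cong (H : Hyp G f X r D) (hr : 2 ≤ r) {Q Q' : Finset W} (hQ : CQ G X r Q)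
    (hQ' : CQ G X r Q') (c : Fin q) : 2 * (r : ℤ) ∣ S f Q c - S f Q' c := by
  obtain ⟨v, hv⟩ := hQ.nonempty
  obtain ⟨v', hv'⟩ := hQ'.nonempty
  obtain ⟨y, hy, Q3, Q4, h3, h4, h3v, h3y, h4y, h4v, -, -⟩ := H.link hr (hQ.1 hv) (hQ'.1 hv')
  have e1 := H.phi hr hQ h3 hv h3v c
  have e2 := H.phi hr h3 h4 h3y h4y c
  have e3 := H.phi hr h4 hQ' h4v hv' c
  refine ⟨(dg f Q v c - dg f Q3 v c) + (dg f Q3 y c - dg f Q4 y c) +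
    (dg f Q4 v' c - dg f Q' v' c), ?_⟩
  linarith

end FewColors

namespace FewColors

variable {W : Type} [DecidableEq W] {q : ℕ} {G : SimpleGraph W} [DecidableRel G.Adj]
  {f : Sym2 W → Fin q} {X : Finset W} {r D : ℕ}

/-- standard basis vector -/
def e (c d : Fin q) : ℤ := if d = c then 1 else 0

lemma e_self (c : Fin q) : e c c = 1 := by simp [e]
lemma e_ne {c d : Fin q} (h : d ≠ c) : e c d = 0 := by simp [e, h]
lemma e_nonneg (c d : Fin q) : 0 ≤ e c d := by unfold e; split_ifs <;> simp
lemma e_le (c d : Fin q) : e c d ≤ 1 := by unfold e; split_ifs <;> simp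
lemma e_sum (c : Fin q) : ∑ d, e c d = 1 := by simp [e]

lemma F_e {u v : W} (h : u ≠ v) (d : Fin q) : F f u v d = e (f s(u, v)) d := by
  rw [F_ne f h]; simp [e, Pi.single_apply]

lemma e_pair {x y z t : Fin q} (h : ∀ d, e x d + e y d = e z d + e t d) (hyt : y ≠ t) :
    x = t ∧ z = y := by
  constructor
  · by_contra hx
    have := h t
    rw [e_ne (Ne.symm hx), e_ne hyt.symm, e_self] at this
    have := e_nonneg z t; omega
  · by_contra hz
    have := h y
    rw [e_ne (Ne.symm hz), e_ne hyt, e_self] at this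
    have := e_nonneg x y; omega

lemma e_inj {x y : Fin q} (h : ∀ d, e x d = e y d) : x = y := by
  by_contra hxy
  have := h x
  rw [e_self, e_ne hxy] at this; omega

def Dprop (G : SimpleGraph W) (f : Sym2 W → Fin q) (X : Finset W) (r : ℕ) : Prop :=
  ∀ Q Q', CQ G X r Q → CQ G X r Q' →
    ∃ c c', ∀ d, S f Q d - S f Q' d = 2 * (r : ℤ) * (e c d - e c' d)

lemma pair_le_sum {s : Fin q → ℤ} (hs : ∀ d, 0 ≤ s d) {c d : Fin q} (h : c ≠ d) :
    s c + s d ≤ ∑ x, s x := by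
  rw [← sum_pair h]
  exact sum_le_sum_of_subset_of_nonneg (subset_univ _) fun i _ _ => hs i

lemma two_vec {s s' : Fin q → ℤ} (hs : ∀ d, 0 ≤ s d) (hs' : ∀ d, 0 ≤ s' d) (h6 : ∑ d, s d = 6)
    (h6' : ∑ d, s' d = 6) (hd : ∀ d, 4 ∣ s d - s' d) :
    ∃ c c', ∀ d, s d - s' d = 4 * (e c d - e c' d) := by
  have hle : ∀ d, s d ≤ 6 := fun d => by
    rw [← h6]; exact single_le_sum (fun i _ => hs i) (mem_univ d)
  have hle' : ∀ d, s' d ≤ 6 := fun d => by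
    rw [← h6']; exact single_le_sum (fun i _ => hs' i) (mem_univ d)
  by_cases hz : ∀ d, s d = s' d
  · have : ∃ c : Fin q, True := by
      by_contra hcon
      push Not at hcon
      have : IsEmpty (Fin q) := ⟨fun c => hcon c⟩
      simp at h6
    obtain ⟨c, -⟩ := this
    exact ⟨c, c, fun d => by rw [hz d]; ring⟩
  · have h1 : ∃ c, s' c < s c := by
      by_contra hcon
      push Not at hcon
      exact hz fun d => (sum_eq_sum_iff_of_le (fun i _ => hcon i)).1 (h6.trans h6'.symm) d (mem_univ d)
    have h2 : ∃ c, s c < s' c := by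
      by_contra hcon
      push Not at hcon
      exact hz fun d =>
        ((sum_eq_sum_iff_of_le (fun i _ => hcon i)).1 (h6'.trans h6.symm) d (mem_univ d)).symm
    obtain ⟨c, hc⟩ := h1
    obtain ⟨c', hc'⟩ := h2
    have hne : c ≠ c' := by rintro rfl; omega
    refine ⟨c, c', fun d => ?_⟩
    have a1 := hd c
    have a2 := hd c'
    have a3 := hd d
    have b1 := hs c
    have b2 := hs' c
    have b3 := hs c'
    have b4 := hs' c'
    have b5 := hs d
    have b6 := hs' d
    have g1 := hle c
    have g2 := hle' c'
    by_cases h1 : d = c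
    · subst h1; rw [e_self, e_ne hne]; omega
    · by_cases h2 : d = c'
      · subst h2; rw [e_self, e_ne hne.symm]; omega
      · rw [e_ne h1, e_ne h2]
        have p1 := pair_le_sum hs h1
        have p2 := pair_le_sum hs' h2
        omega

lemma Hyp.D2 (H : Hyp G f X 2 D) : Dprop G f X 2 := by
  intro Q Q' hQ hQ'
  have := two_vec (s := S f Q) (s' := S f Q') (S_nonneg f Q) (S_nonneg f Q')
    (by rw [S_sum, hQ.2.card_eq]; norm_num) (by rw [S_sum, hQ'.2.card_eq]; norm_num)
    (fun d => by have := H.cong le_rfl hQ hQ' d; norm_num at this; exact this)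
  obtain ⟨c, c', h⟩ := this
  exact ⟨c, c', fun d => by rw [h d]; norm_num⟩

lemma CQ.erase {Q : Finset W} {z : W} (h : CQ G X r Q) (hz : z ∈ Q) :
    G.IsNClique r (Q.erase z) := by
  have := h.sub (erase_subset z Q)
  rwa [card_erase_of_mem hz, h.2.card_eq, Nat.add_sub_cancel] at this

lemma S_er {Q : Finset W} {w : W} (hw : w ∈ Q) (d : Fin q) :
    S f Q d = S f (Q.erase w) d + 2 * dg f Q w d := by
  rw [S_erase f hw]; simp

/-- the conclusion of the sharing lemma -/
def Share (G : SimpleGraph W) (f : Sym2 W → Fin q) (X : Finset W) (r : ℕ) : Prop :=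
  ∀ z Q Q', CQ G X r Q → CQ G X r Q' → z ∈ Q → z ∈ Q' →
    ∃ c c', ∀ d, dg f Q z d - dg f Q' z d = e c d - e c' d

lemma Hyp.share (H : Hyp G f X r D) (hr : 3 ≤ r)
    (ih : ∀ z ∈ X, Dprop G f (X.filter (G.Adj z)) (r - 1)) : Share G f X r := by
  intro z Q Q' hQ hQ' hz hz'
  have key : ∀ Q, CQ G X r Q → z ∈ Q → CQ G (X.filter (G.Adj z)) (r - 1) (Q.erase z) := by
    intro Q hQ hz
    refine ⟨?_, ?_⟩
    · intro x hx
      rw [mem_erase] at hx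
      exact mem_filter.2 ⟨hQ.1 hx.2, hQ.adj hz hx.2 (Ne.symm hx.1)⟩
    · have := hQ.erase hz
      rwa [show r = r - 1 + 1 by omega] at this
  obtain ⟨c, c', h⟩ := ih z (hQ.1 hz) _ _ (key Q hQ hz) (key Q' hQ' hz')
  refine ⟨c, c', fun d => ?_⟩
  have h1 := h d
  have h2 := H.phi (by omega) hQ hQ' hz hz' d
  have h3 := S_er (f := f) hz d
  have h4 := S_er (f := f) hz' d
  push_cast [show 1 ≤ r by omega] at h1
  have h5 : (2 * (r : ℤ) - 2) * (dg f Q z d - dg f Q' z d - (e c d - e c' d)) = 0 := by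
    linarith
  rcases mul_eq_zero.1 h5 with h6 | h6
  · omega
  · linarith

lemma star_dg {P : Finset W} {w : W} {c : Fin q} (hw : w ∉ P) (h : ∀ u ∈ P, f s(u, w) = c)
    (d : Fin q) : dg f P w d = P.card * e c d := by
  unfold dg
  rw [Finset.sum_apply, sum_congr rfl (g := fun _ => e c d)]
  · simp
  · intro u hu
    rw [F_comm, F_e (by rintro rfl; exact hw hu), h u hu]

lemma dg_insert_self {P : Finset W} {w : W} (hw : w ∉ P) (d : Fin q) :
    dg f (insert w P) w d = dg f P w d := by
  rw [dg_insert f hw, F_self]; simp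

lemma S_ins {P : Finset W} {w : W} (hw : w ∉ P) (d : Fin q) :
    S f (insert w P) d = S f P d + 2 * dg f P w d := by
  rw [S_insert f hw]; simp

lemma Hyp.swap (H : Hyp G f X r D) {P : Finset W} (hP : P ⊆ X) (hr : 1 ≤ r) (hPc : G.IsNClique r P)
    {w z : W} (hw : w ∈ X) (hz : z ∈ X) (hwa : ∀ u ∈ P, G.Adj u w) (hza : ∀ u ∈ P, G.Adj u z) :
    (∀ d, S f (insert z P) d = S f (insert w P) d) ∨
      ∃ c cz, c ≠ cz ∧ (∀ u ∈ P, f s(u, w) = c) ∧ (∀ u ∈ P, f s(u, z) = cz) := by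
  by_cases h : ∀ u ∈ P, f s(u, w) = f s(u, z)
  · left
    intro d
    rw [S_ins (notMem_of_adj hza), S_ins (notMem_of_adj hwa)]
    have : dg f P z = dg f P w := by
      unfold dg
      refine sum_congr rfl fun u hu => ?_
      rw [F_comm, F_comm f w, F_ne f (hza u hu).ne, F_ne f (hwa u hu).ne, h u hu]
    rw [this]
  · right
    push Not at h
    obtain ⟨a, ha, hne⟩ := h
    have key : ∀ u ∈ P, f s(u, w) = f s(a, w) ∧ f s(u, z) = f s(a, z) := by
      intro u hu
      by_cases hua : u = a
      · subst hua; exact ⟨rfl, rfl⟩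
      have hR : G.IsNClique (r - 1) (P.erase a) := by
        refine ⟨hPc.isClique.subset (by exact_mod_cast erase_subset a P), ?_⟩
        rw [card_erase_of_mem ha, hPc.card_eq]
      have hadj : ∀ x ∈ P.erase a, G.Adj x a := fun x hx =>
        hPc.isClique (mem_of_mem_erase hx) ha (ne_of_mem_erase hx)
      have hE := H.E (P.erase a) ((erase_subset _ _).trans hP) hR u (mem_erase.2 ⟨hua, hu⟩)
        a (hP ha) w hw a (hP ha) z hz hadj (fun x hx => hwa x (mem_of_mem_erase hx)) hadj
        (fun x hx => hza x (mem_of_mem_erase hx)) (hwa a ha) (hza a ha)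
      have := e_pair (x := f s(u, w)) (y := f s(a, z)) (z := f s(u, z)) (t := f s(a, w)) (by
        intro d
        have h1 := congrFun hE d
        simp only [Pi.add_apply] at h1
        rw [F_e (hwa u hu).ne, F_e (hza u hu).ne, F_e (hwa a ha).ne, F_e (hza a ha).ne] at h1
        linarith) (Ne.symm hne)
      exact this
    exact ⟨f s(a, w), f s(a, z), hne, fun u hu => (key u hu).1, fun u hu => (key u hu).2⟩

lemma CQ_insert {P : Finset W} (hP : P ⊆ X) (hPc : G.IsNClique r P) {w : W} (hw : w ∈ X)
    (hwa : ∀ u ∈ P, G.Adj u w) : CQ G X r (insert w P) :=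
  ⟨insert_subset hw hP, isNClique_insert hPc hwa⟩

lemma Hyp.join (H : Hyp G f X r D) (hr : 2 ≤ r) (hSh : Share G f X r) {P P' : Finset W}
    (hP : P ⊆ X) (hPc : G.IsNClique r P) (hP' : P' ⊆ X) (hPc' : G.IsNClique r P')
    {w w' z : W} (hw : w ∈ X) (hw' : w' ∈ X) (hz : z ∈ X) (hwa : ∀ u ∈ P, G.Adj u w)
    (hwa' : ∀ u ∈ P', G.Adj u w') (hza : ∀ u ∈ P, G.Adj u z) (hza' : ∀ u ∈ P', G.Adj u z) :
    ∃ c c', ∀ d, S f (insert w P) d - S f (insert w' P') d = 2 * (r : ℤ) * (e c d - e c' d) := by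
  have hQ := CQ_insert hP hPc hz hza
  have hQ' := CQ_insert hP' hPc' hz hza'
  obtain ⟨x, y, hxy⟩ := hSh z _ _ hQ hQ' (mem_insert_self _ _) (mem_insert_self _ _)
  have hph := H.phi hr hQ hQ' (mem_insert_self _ _) (mem_insert_self _ _)
  have hSS : ∀ d, S f (insert z P) d - S f (insert z P') d = 2 * (r : ℤ) * (e x d - e y d) := by
    intro d; rw [← hph d, hxy d]
  have hzP := notMem_of_adj hza
  have hzP' := notMem_of_adj hza'
  have hwP := notMem_of_adj hwa
  have hwP' := notMem_of_adj hwa'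
  have hnn := dg_nonneg f (insert z P) z
  have hnn' := dg_nonneg f (insert z P') z
  rcases H.swap hP (by omega) hPc hw hz hwa hza with h1 | ⟨c, cz, hc, h1, h2⟩
  · rcases H.swap hP' (by omega) hPc' hw' hz hwa' hza' with h1' | ⟨c', cz', hc', h1', h2'⟩
    · exact ⟨x, y, fun d => by rw [← h1, ← h1', hSS]⟩
    · have s1 : ∀ d, S f (insert w' P') d = S f (insert z P') d - 2 * r * (e cz' d - e c' d) := by
        intro d
        rw [S_ins hzP', S_ins hwP', star_dg hzP' h2', star_dg hwP' h1', hPc'.card_eq]; ring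
      have g : ∀ d, dg f (insert z P) z d = r * e cz' d + e x d - e y d := by
        intro d
        have := hxy d
        rw [dg_insert_self hzP', star_dg hzP' h2', hPc'.card_eq] at this
        linarith
      by_cases hyx : y = x
      · exact ⟨cz', c', fun d => by rw [s1, ← h1]; have := hSS d; rw [hyx] at this; linarith⟩
      by_cases hyc : y = cz'
      · exact ⟨x, c', fun d => by rw [s1, ← h1]; have := hSS d; rw [hyc] at this; linarith⟩
      · exfalso
        have := hnn y
        rw [g, e_self, e_ne hyx, e_ne hyc] at this
        omega
  · have s1 : ∀ d, S f (insert w P) d = S f (insert z P) d - 2 * r * (e cz d - e c d) := by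
      intro d
      rw [S_ins hzP, S_ins hwP, star_dg hzP h2, star_dg hwP h1, hPc.card_eq]; ring
    rcases H.swap hP' (by omega) hPc' hw' hz hwa' hza' with h1' | ⟨c', cz', hc', h1', h2'⟩
    · have g : ∀ d, dg f (insert z P') z d = r * e cz d - e x d + e y d := by
        intro d
        have := hxy d
        rw [dg_insert_self hzP, star_dg hzP h2, hPc.card_eq] at this
        linarith
      by_cases hxy' : x = y
      · exact ⟨c, cz, fun d => by rw [s1, ← h1']; have := hSS d; rw [hxy'] at this; linarith⟩
      by_cases hxc : x = cz
      · exact ⟨c, y, fun d => by rw [s1, ← h1']; have := hSS d; rw [hxc] at this; linarith⟩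
      · exfalso
        have := hnn' x
        rw [g, e_self, e_ne hxy', e_ne hxc] at this
        omega
    · have s1' : ∀ d, S f (insert w' P') d = S f (insert z P') d - 2 * r * (e cz' d - e c' d) := by
        intro d
        rw [S_ins hzP', S_ins hwP', star_dg hzP' h2', star_dg hwP' h1', hPc'.card_eq]; ring
      have g : ∀ d, (r : ℤ) * e cz d - r * e cz' d = e x d - e y d := by
        intro d
        have := hxy d
        rw [dg_insert_self hzP, star_dg hzP h2, hPc.card_eq,
          dg_insert_self hzP', star_dg hzP' h2', hPc'.card_eq] at this
        linarith
      have hcc : cz = cz' := by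
        by_contra hne
        have := g cz
        rw [e_self, e_ne hne] at this
        have := e_le x cz
        have := e_nonneg y cz
        omega
      refine ⟨c, c', fun d => ?_⟩
      have h3 := g d
      have h4 := hSS d
      rw [s1, s1']
      rw [hcc] at h3 ⊢
      have h5 : e x d - e y d = 0 := by linarith
      rw [h5] at h4
      linarith

end FewColors

namespace FewColors

variable {W : Type} [DecidableEq W] {q : ℕ} {G : SimpleGraph W} [DecidableRel G.Adj]
  {f : Sym2 W → Fin q} {X : Finset W} {r D : ℕ}

def Mono (f : Sym2 W → Fin q) (P : Finset W) (m : Fin q) : Prop :=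
  ∀ u ∈ P, ∀ v ∈ P, u ≠ v → f s(u, v) = m

lemma Mono.sub {P P' : Finset W} {m : Fin q} (h : Mono f P m) (hP : P' ⊆ P) : Mono f P' m :=
  fun u hu v hv => h u (hP hu) v (hP hv)

lemma Mono.dg {P : Finset W} {m : Fin q} (h : Mono f P m) {v : W} (hv : v ∈ P) (d : Fin q) :
    dg f P v d = ((P.card : ℤ) - 1) * e m d := by
  rw [← dg_erase, star_dg (c := m) (notMem_erase v P) (fun u hu => h u (mem_of_mem_erase hu) v hv
    (ne_of_mem_erase hu)), card_erase_of_mem hv]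
  have : 1 ≤ P.card := card_pos.2 ⟨v, hv⟩
  push_cast [this]; ring

lemma Mono.S {P : Finset W} {m : Fin q} (h : Mono f P m) (d : Fin q) :
    S f P d = P.card * ((P.card : ℤ) - 1) * e m d := by
  unfold FewColors.S
  rw [Finset.sum_apply, sum_congr rfl fun v hv => h.dg hv d]
  simp; ring

lemma mono_of_S {P : Finset W} {m : Fin q} {k : ℤ} (h : ∀ d, S f P d = k * e m d) : Mono f P m := by
  intro u hu v hv huv
  by_contra hne
  have := S_color f hu hv huv
  rw [h, e_ne hne] at this
  omega

/-- cliques through a vertex that is a star over a monochromatic clique -/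
lemma Hyp.star_fix (H : Hyp G f X r D) (hr : 2 ≤ r) (hSh : Share G f X r) {P : Finset W}
    (hP : P ⊆ X) (hPc : G.IsNClique r P) {i : W} (hi : i ∈ X) (hia : ∀ u ∈ P, G.Adj u i)
    {m c : Fin q} (hm : Mono f P m) (hc : ∀ u ∈ P, f s(u, i) = c) (hcm : c ≠ m)
    {Q : Finset W} (hQ : CQ G X r Q) (hiQ : i ∈ Q) :
    (∀ d, S f Q d = S f (insert i P) d) ∧ (∀ d, dg f Q i d = r * e c d) := by
  have hQ0 := CQ_insert hP hPc hi hia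
  have hiP := notMem_of_adj hia
  have hd0 : ∀ d, dg f (insert i P) i d = r * e c d := fun d => by
    rw [dg_insert_self hiP, star_dg hiP hc, hPc.card_eq]
  obtain ⟨x, y, hxy⟩ := hSh i _ _ hQ hQ0 hiQ (mem_insert_self _ _)
  have hph := H.phi hr hQ hQ0 hiQ (mem_insert_self _ _)
  by_cases hne : y = x
  · subst hne
    have : ∀ d, dg f Q i d = dg f (insert i P) i d := fun d => by have := hxy d; linarith
    refine ⟨fun d => ?_, fun d => by rw [this, hd0]⟩
    have h2 := hph d
    rw [this] at h2; linarith
  · exfalso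
    have hyc : y = c := by
      by_contra hyc
      have h1 := hxy y
      rw [hd0, e_self, e_ne hne, e_ne hyc] at h1
      have := dg_nonneg f Q i y
      omega
    subst hyc
    have h1 := hxy y
    have h2 := hph y
    have h3 := dg_le_S f Q hiQ y
    rw [h1] at h2
    rw [hd0, e_self, e_ne hne] at h1
    rw [S_ins hiP, star_dg hiP hc, hm.S, e_self, e_ne hne, e_ne hcm, hPc.card_eq] at h2
    have h4 : S f Q y = 0 := by linarith
    have : (2:ℤ) ≤ r := by exact_mod_cast hr
    linarith

lemma Hyp.star_y (H : Hyp G f X r D) (hr : 2 ≤ r) (hSh : Share G f X r) {P : Finset W}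
    (hP : P ⊆ X) (hPc : G.IsNClique r P) {i : W} (hi : i ∈ X) (hia : ∀ u ∈ P, G.Adj u i)
    {m c : Fin q} (hm : Mono f P m) (hc : ∀ u ∈ P, f s(u, i) = c) (hcm : c ≠ m)
    {Q : Finset W} (hQ : CQ G X r Q) (hiQ : i ∈ Q) {y : W} (hy : y ∈ Q) (hyi : y ≠ i) (d : Fin q) :
    2 * (r : ℤ) * dg f Q y d - S f Q d = r * (r - 1) * e m d := by
  obtain ⟨h1, h2⟩ := H.star_fix hr hSh hP hPc hi hia hm hc hcm hQ hiQ
  have hiP := notMem_of_adj hia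
  have hS : ∀ d, S f Q d = r * (r - 1) * e m d + 2 * r * e c d := fun d => by
    rw [h1, S_ins hiP, hm.S, star_dg hiP hc, hPc.card_eq]; ring
  have hS' : ∀ d, S f (Q.erase i) d = (r * (r - 1)) * e m d := fun d => by
    have := S_er (f := f) hiQ d
    rw [hS, h2] at this; linarith
  have hmono := mono_of_S hS'
  have hyQ : y ∈ Q.erase i := mem_erase.2 ⟨hyi, hy⟩
  have hfc : f s(y, i) = c := by
    by_contra hne
    have := F_le_dg f Q i hy (f s(y, i))
    rw [h2, F_comm, F_e hyi, e_self, e_ne hne] at this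
    omega
  have h3 : dg f Q y d = e c d + (r - 1) * e m d := by
    have := dg_insert f (notMem_erase i Q) y
    rw [insert_erase hiQ] at this
    rw [this, Pi.add_apply, F_e hyi, hfc, hmono.dg hyQ, (hQ.erase hiQ).card_eq]
  rw [h3, hS]; ring

open Classical in
/-- the set of vertices joined to a clique with the same color statistics as `Q` -/
noncomputable def Zs (G : SimpleGraph W) (f : Sym2 W → Fin q) (X : Finset W) (r : ℕ) (Q : Finset W) :
    Finset W :=
  X.filter fun z => ∃ P w, P ⊆ X ∧ G.IsNClique r P ∧ w ∈ X ∧ (∀ u ∈ P, G.Adj u w) ∧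
    (∀ u ∈ P, G.Adj u z) ∧ ∀ d, S f (insert w P) d = S f Q d

lemma mem_Zs {Q : Finset W} {z : W} : z ∈ Zs G f X r Q ↔ z ∈ X ∧
    ∃ P w, P ⊆ X ∧ G.IsNClique r P ∧ w ∈ X ∧ (∀ u ∈ P, G.Adj u w) ∧
    (∀ u ∈ P, G.Adj u z) ∧ ∀ d, S f (insert w P) d = S f Q d := by
  classical
  unfold Zs; rw [mem_filter]

lemma Hyp.Zs_join (H : Hyp G f X r D) (hr : 2 ≤ r) (hSh : Share G f X r) {Q Q' : Finset W}
    (h : X.card < (Zs G f X r Q).card + (Zs G f X r Q').card) :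
    ∃ c c', ∀ d, S f Q d - S f Q' d = 2 * (r : ℤ) * (e c d - e c' d) := by
  have hsub : ∀ Q, Zs G f X r Q ⊆ X := fun Q z hz => (mem_Zs.1 hz).1
  obtain ⟨z, hz⟩ := inter_nonempty_of_card_lt_card_add_card (hsub Q) (hsub Q') h
  rw [mem_inter] at hz
  obtain ⟨hzX, P, w, hP, hPc, hw, hwa, hza, hS⟩ := mem_Zs.1 hz.1
  obtain ⟨-, P', w', hP', hPc', hw', hwa', hza', hS'⟩ := mem_Zs.1 hz.2
  obtain ⟨c, c', h⟩ := H.join hr hSh hP hPc hP' hPc' hw hw' hzX hwa hwa' hza hza'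
  exact ⟨c, c', fun d => by rw [← hS, ← hS', h]⟩

/-- the second alternative -/
def Beta (G : SimpleGraph W) (f : Sym2 W → Fin q) (X : Finset W) (r : ℕ) (Q : Finset W) : Prop :=
  ∃ (P : Finset W) (i : W) (m c : Fin q), P ⊆ X ∧ G.IsNClique r P ∧ i ∈ X ∧ (∀ u ∈ P, G.Adj u i) ∧
    Mono f P m ∧ (∀ u ∈ P, f s(u, i) = c) ∧ c ≠ m ∧
    ∀ d, S f Q d = (r + 1) * r * e m d

lemma Hyp.beta_beta (H : Hyp G f X r D) (hr : 2 ≤ r) (hSh : Share G f X r) {Q Q' : Finset W}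
    (h : Beta G f X r Q) (h' : Beta G f X r Q') (d : Fin q) : S f Q d = S f Q' d := by
  obtain ⟨P, i, m, c, hP, hPc, hi, hia, hm, hc, hcm, hS⟩ := h
  obtain ⟨P', i', m', c', hP', hPc', hi', hia', hm', hc', hcm', hS'⟩ := h'
  obtain ⟨y, hy, Q3, Q4, h3, h4, h3i, h3y, h4y, h4i, a1, a2⟩ := H.link hr hi hi'
  have e1 := fun d => H.star_y hr hSh hP hPc hi hia hm hc hcm h3 h3i h3y a1.ne.symm d
  have e2 := fun d => H.star_y hr hSh hP' hPc' hi' hia' hm' hc' hcm' h4 h4i h4y a2.ne.symm d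
  have hph := H.phi hr h3 h4 h3y h4y
  have hmm : m = m' := by
    apply e_inj
    intro d
    have h5 : ((r : ℤ) * (r - 1)) * (e m d - e m' d) = 0 := by
      have := hph d
      have := e1 d
      have := e2 d
      linarith
    have hr' : (2 : ℤ) ≤ r := by exact_mod_cast hr
    rcases mul_eq_zero.1 h5 with h6 | h6
    · exfalso; rcases mul_eq_zero.1 h6 with h7 | h7 <;> omega
    · linarith
  rw [hS, hS', hmm]

lemma Hyp.Zs_of_good (H : Hyp G f X r D) (hr : 2 ≤ r) {Q : Finset W} {v : W} (hv : v ∈ X)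
    (h : ∀ Q', CQ G X r Q' → v ∈ Q' → ∀ d, S f Q' d = S f Q d) :
    X.card ≤ (Zs G f X r Q).card + D := by
  have hsub : X.filter (G.Adj v) ⊆ Zs G f X r Q := by
    intro z hz
    obtain ⟨hzX, hvz⟩ := mem_filter.1 hz
    have : G.IsNClique (1 + 1) (insert z {v}) := isNClique_insert (by
      simp [SimpleGraph.isNClique_iff]) (by simpa using hvz)
    obtain ⟨Q', hQ', hc⟩ := H.extend' (insert_subset hzX (singleton_subset_iff.2 hv)) this (by omega)
    have hvQ : v ∈ Q' := hQ' (by simp)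
    have hzQ : z ∈ Q' := hQ' (by simp)
    have hadj : ∀ u ∈ Q'.erase z, G.Adj u z := fun u hu =>
      hc.adj (mem_of_mem_erase hu) hzQ (ne_of_mem_erase hu)
    refine mem_Zs.2 ⟨hzX, Q'.erase z, z, (erase_subset _ _).trans hc.1, hc.erase hzQ, hzX, hadj,
      hadj, ?_⟩
    rw [insert_erase hzQ]
    exact h Q' hc hvQ
  have h1 := card_le_card hsub
  have h2 := card_filter_add_card_filter_not (s := X) (G.Adj v)
  have h3 := H.nn v hv
  omega

end FewColors

namespace FewColors

variable {W : Type} [DecidableEq W] {q : ℕ} {G : SimpleGraph W} [DecidableRel G.Adj]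
  {f : Sym2 W → Fin q} {X : Finset W} {r D : ℕ}

lemma Hyp.count (H : Hyp G f X r D) (hr : 1 ≤ r) {T Z : Finset W} (hT : T ⊆ X) (hs : r + 1 ≤ T.card)
    (hZX : Z ⊆ X) (hZ : ∀ z ∈ X, r ≤ (T.filter fun t => G.Adj t z).card → z ∈ Z) :
    (T.card : ℤ) * X.card ≤ T.card * D + (r - 1) * X.card + (T.card - r) * Z.card +
      (X.filter fun z => ∀ t ∈ T, G.Adj t z).card := by
  have h1 : ∑ t ∈ T, (X.filter fun z => G.Adj t z).card =
      ∑ z ∈ X, (T.filter fun t => G.Adj t z).card :=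
    sum_card_bipartiteAbove_eq_sum_card_bipartiteBelow (s := T) (t := X) (fun t z => G.Adj t z)
  have h2 : (T.card : ℤ) * (X.card - D) ≤ ∑ t ∈ T, ((X.filter fun z => G.Adj t z).card : ℤ) := by
    rw [← nsmul_eq_mul]
    apply card_nsmul_le_sum
    intro t ht
    have a1 : (X.filter fun z => G.Adj t z).card + (X.filter fun z => ¬ G.Adj t z).card = X.card :=
      card_filter_add_card_filter_not (s := X) (G.Adj t)
    have a2 := H.nn t (hT ht)
    omega
  have h3 : ∑ z ∈ X, ((T.filter fun t => G.Adj t z).card : ℤ) ≤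
      ∑ z ∈ X, (((r : ℤ) - 1) + (T.card - r) * (if z ∈ Z then 1 else 0) +
        (if ∀ t ∈ T, G.Adj t z then 1 else 0)) := by
    apply sum_le_sum
    intro z hz
    by_cases hzZ : z ∈ Z
    · rw [if_pos hzZ]
      by_cases hE : ∀ t ∈ T, G.Adj t z
      · rw [if_pos hE]
        have := card_filter_le T fun t => G.Adj t z
        omega
      · rw [if_neg hE]
        have : (T.filter fun t => G.Adj t z).card < T.card := by
          apply card_lt_card
          rw [filter_ssubset]
          push Not at hE; exact hE
        omega
    · rw [if_neg hzZ]
      have hlt : ¬ r ≤ (T.filter fun t => G.Adj t z).card := fun h => hzZ (hZ z hz h)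
      split_ifs <;> omega
  have h4 : ∑ z ∈ X, (((r : ℤ) - 1) + (T.card - r) * (if z ∈ Z then 1 else 0) +
        (if ∀ t ∈ T, G.Adj t z then 1 else 0)) = (r - 1) * X.card + (T.card - r) * Z.card +
      (X.filter fun z => ∀ t ∈ T, G.Adj t z).card := by
    rw [sum_add_distrib, sum_add_distrib, ← mul_sum]
    simp only [sum_const, nsmul_eq_mul, sum_boole]
    rw [filter_mem_eq_inter, inter_eq_right.2 hZX]
    ring
  have h1' : ∑ t ∈ T, ((X.filter fun z => G.Adj t z).card : ℤ) =
      ∑ z ∈ X, ((T.filter fun t => G.Adj t z).card : ℤ) := by exact_mod_cast h1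
  rw [h1'] at h2
  have := h2.trans (h3.trans h4.le)
  linarith

lemma arith0 {s n D r z : ℤ} (hs : r + 1 ≤ s) (hn : r * D < n)
    (h : s * n ≤ s * D + (r - 1) * n + (s - r) * z) : n ≤ z + D := by
  by_contra hcon
  push Not at hcon
  nlinarith [mul_le_mul_of_nonneg_left hcon.le (show 0 ≤ s - r by linarith)]

lemma arith1 {s n D r z : ℤ} (hs : r + 1 ≤ s) (hD : 0 ≤ D) (hn : r * D < n)
    (h : s * n ≤ s * D + (r - 1) * n + (s - r) * z + D) : n ≤ z + 2 * D := by
  by_contra hcon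
  push Not at hcon
  nlinarith [mul_le_mul_of_nonneg_left hcon.le (show 0 ≤ s - r by linarith),
    mul_nonneg hD (show 0 ≤ s - r - 1 by linarith)]

lemma Hyp.dich (H : Hyp G f X r D) (hr : 3 ≤ r) (hSh : Share G f X r) {Q : Finset W}
    (hQ : CQ G X r Q) : X.card ≤ (Zs G f X r Q).card + D ∨
      (X.card ≤ (Zs G f X r Q).card + 2 * D ∧ Beta G f X r Q) := by
  classical
  -- the maximal uniform clique
  let A : Finset (Finset W) := X.powerset.filter fun T => Q ⊆ T ∧ G.IsClique (T : Set W) ∧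
    ∀ Q1 ⊆ T, Q1.card = r + 1 → ∀ d, S f Q1 d = S f Q d
  have hQA : Q ∈ A := by
    refine mem_filter.2 ⟨mem_powerset.2 hQ.1, Subset.rfl, hQ.2.isClique, ?_⟩
    intro Q1 h1 h2 d
    rw [eq_of_subset_of_card_le h1 (by rw [h2, hQ.2.card_eq])]
  obtain ⟨T, hTA, hTmax⟩ := A.exists_max_image card ⟨Q, hQA⟩
  obtain ⟨hTX, hQT, hTc, hTu⟩ := mem_filter.1 hTA
  rw [mem_powerset] at hTX
  have hs : r + 1 ≤ T.card := by rw [← hQ.2.card_eq]; exact card_le_card hQT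
  have hsubc : ∀ P ⊆ T, ∀ n, P.card = n → G.IsNClique n P := fun P hP n hn =>
    ⟨hTc.subset (by exact_mod_cast hP), hn⟩
  have hZX : Zs G f X r Q ⊆ X := fun z hz => (mem_Zs.1 hz).1
  have hZ : ∀ z ∈ X, r ≤ (T.filter fun t => G.Adj t z).card → z ∈ Zs G f X r Q := by
    intro z hz hle
    obtain ⟨P, hPs, hPcard⟩ := exists_subset_card_eq hle
    have hPT : P ⊆ T := hPs.trans (filter_subset _ _)
    obtain ⟨w, hwT, hwP⟩ := exists_mem_notMem_of_card_lt_card (s := P) (t := T) (by omega)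
    refine mem_Zs.2 ⟨hz, P, w, hPT.trans hTX, hsubc P hPT r hPcard, hTX hwT, ?_, ?_, ?_⟩
    · intro u hu; exact hTc (hPT hu) hwT (by rintro rfl; exact hwP hu)
    · intro u hu; exact (mem_filter.1 (hPs hu)).2
    · exact hTu _ (insert_subset hwT hPT) (by rw [card_insert_of_notMem hwP, hPcard])
  have hcount := H.count (by omega) hTX hs hZX hZ
  have hbig : (r : ℤ) * D < X.card := by exact_mod_cast H.big
  have hsZ : (r : ℤ) + 1 ≤ T.card := by exact_mod_cast hs
  set E0 := X.filter fun z => ∀ t ∈ T, G.Adj t z with hE0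
  have hnotU : ∀ z ∈ E0, ¬ ∀ Q1 ⊆ insert z T, Q1.card = r + 1 → ∀ d, S f Q1 d = S f Q d := by
    intro z hz hU
    obtain ⟨hzX, hzT⟩ := mem_filter.1 hz
    have : insert z T ∈ A := by
      refine mem_filter.2 ⟨mem_powerset.2 (insert_subset hzX hTX), hQT.trans (subset_insert _ _),
        ?_, hU⟩
      exact (isNClique_insert (hsubc T Subset.rfl _ rfl) hzT).isClique
    have := hTmax _ this
    rw [card_insert_of_notMem (notMem_of_adj hzT)] at this
    omega
  rcases E0.eq_empty_or_nonempty with hem | ⟨z, hz⟩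
  · left
    rw [hem, card_empty] at hcount
    have := arith0 (z := (Zs G f X r Q).card) hsZ hbig (by simpa using hcount)
    exact_mod_cast this
  obtain ⟨hzX, hzT⟩ := mem_filter.1 hz
  have hzn := hnotU z hz
  push Not at hzn
  obtain ⟨Q1, hQ1s, hQ1c, d0, hQ1ne⟩ := hzn
  have hzQ1 : z ∈ Q1 := by
    by_contra hcon
    exact hQ1ne (hTu Q1 ((subset_insert_iff_of_notMem hcon).1 hQ1s) hQ1c d0)
  obtain ⟨P, hPdef⟩ : ∃ P, P = Q1.erase z := ⟨_, rfl⟩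
  have hPT : P ⊆ T := by rw [hPdef]; exact subset_insert_iff.1 hQ1s
  have hPcard : P.card = r := by rw [hPdef, card_erase_of_mem hzQ1, hQ1c]; simp
  have hPc := hsubc P hPT r hPcard
  have hQ1 : insert z P = Q1 := by rw [hPdef, insert_erase hzQ1]
  obtain ⟨v, hvT, hvP⟩ := exists_mem_notMem_of_card_lt_card (s := P) (t := T) (by omega)
  have hva : ∀ u ∈ P, G.Adj u v := fun u hu => hTc (hPT hu) hvT (by rintro rfl; exact hvP hu)
  have hza : ∀ u ∈ P, G.Adj u z := fun u hu => hzT u (hPT hu)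
  have hSv : ∀ d, S f (insert v P) d = S f Q d :=
    hTu _ (insert_subset hvT hPT) (by rw [card_insert_of_notMem hvP, hPcard])
  rcases H.swap (hPT.trans hTX) (by omega) hPc (hTX hvT) hzX hva hza with h1 | ⟨c, cz, hc, hvc, hzc⟩
  · exfalso; apply hQ1ne; rw [← hQ1, h1, hSv]
  have hvz : G.Adj v z := hzT v hvT
  have hpair : ∀ u ∈ P, ∀ a ∈ P, u ≠ a → ∀ d, e (f s(u, a)) d + e (f s(v, z)) d = e cz d + e c d := by
    intro u hu a ha hua d
    have hadj : ∀ x ∈ P.erase a, G.Adj x a := fun x hx =>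
      hPc.isClique (mem_of_mem_erase hx) ha (ne_of_mem_erase hx)
    have hE := H.E (P.erase a) ((erase_subset _ _).trans (hPT.trans hTX))
      (hsubc _ ((erase_subset _ _).trans hPT) _ (by rw [card_erase_of_mem ha, hPcard]))
      u (mem_erase.2 ⟨hua, hu⟩) a (hTX (hPT ha)) v (hTX hvT) v (hTX hvT) z hzX hadj
      (fun x hx => hva x (mem_of_mem_erase hx)) (fun x hx => hva x (mem_of_mem_erase hx))
      (fun x hx => hza x (mem_of_mem_erase hx)) (hva a ha) hvz
    have h1 := congrFun hE d
    simp only [Pi.add_apply] at h1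
    rw [F_e hua, F_e (hva u hu).ne, F_e (hza u hu).ne, F_e (hva a ha).ne, F_e hvz.ne,
      hvc u hu, hvc a ha, hzc u hu] at h1
    linarith
  by_cases hfc : f s(v, z) = c
  · -- first alternative
    left
    have hmono : Mono f P cz := by
      intro u hu a ha hua
      apply e_inj
      intro d
      have := hpair u hu a ha hua d
      rw [hfc] at this; linarith
    apply H.Zs_of_good (by omega) (hTX hvT)
    intro Q' hQ' hv' d
    rw [(H.star_fix (by omega) hSh (hPT.trans hTX) hPc (hTX hvT) hva hmono hvc hc hQ' hv').1, hSv]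
  · right
    have hmonoP : Mono f P c := by
      intro u hu a ha hua
      exact (e_pair (hpair u hu a ha hua) hfc).1
    have hmono : Mono f (insert v P) c := by
      intro u hu a ha hua
      rcases mem_insert.1 hu with rfl | hu2
      · rcases mem_insert.1 ha with rfl | ha
        · exact absurd rfl hua
        · rw [Sym2.eq_swap]; exact hvc a ha
      · rcases mem_insert.1 ha with rfl | ha
        · exact hvc u hu2
        · exact hmonoP u hu2 a ha hua
    have hSQ : ∀ d, S f Q d = (r + 1) * r * e c d := by
      intro d
      rw [← hSv, hmono.S, card_insert_of_notMem hvP, hPcard]; push_cast; ring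
    refine ⟨?_, P, z, c, cz, hPT.trans hTX, hPc, hzX, hza, hmonoP, hzc, hc.symm, hSQ⟩
    -- all of T is monochromatic
    have hTm : Mono f T c := by
      intro u hu a ha hua
      obtain ⟨Q2, h1, h2, h3⟩ := exists_subsuperset_card_eq (s := {u, a}) (t := T) (n := r + 1)
        (by simp [insert_subset_iff, hu, ha]) (card_le_two.trans (by omega)) hs
      have hm2 : Mono f Q2 c := mono_of_S (k := (r + 1) * r) fun d => by rw [hTu Q2 h2 h3, hSQ]
      exact hm2 u (h1 (by simp)) a (h1 (by simp)) hua
    have hstar : ∀ z ∈ E0, ∃ k, k ≠ c ∧ ∀ t ∈ T, f s(t, z) = k := by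
      intro z hz
      obtain ⟨hzX, hzT⟩ := mem_filter.1 hz
      obtain ⟨t0, ht0⟩ : T.Nonempty := card_pos.1 (by omega)
      have hall : ∀ t ∈ T, f s(t, z) = f s(t0, z) := by
        intro t ht
        by_cases htt : t0 = t
        · rw [htt]
        obtain ⟨a, haT, ha⟩ := exists_mem_notMem_of_card_lt_card (s := {t0, t}) (t := T)
          (card_le_two.trans_lt (by omega))
        simp only [mem_insert, mem_singleton, not_or] at ha
        obtain ⟨R, h1, h2, h3⟩ := exists_subsuperset_card_eq (s := {t0}) (t := (T.erase a).erase t)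
          (n := r - 1) (by simp [ht0, htt, Ne.symm ha.1]) (by simp; omega)
          (by
            rw [card_erase_of_mem (mem_erase.2 ⟨Ne.symm ha.2, ht⟩), card_erase_of_mem haT]; omega)
        have hRT : R ⊆ T := h2.trans ((erase_subset _ _).trans (erase_subset _ _))
        have hRa : ∀ w ∈ R, G.Adj w a := fun w hw => hTc (hRT hw) haT (by
          rintro rfl; simpa using h2 hw)
        have hRt : ∀ w ∈ R, G.Adj w t := fun w hw => hTc (hRT hw) ht (by
          rintro rfl; simpa using h2 hw)
        have hat : G.Adj a t := hTc haT ht ha.2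
        have ht0R : t0 ∈ R := h1 (by simp)
        have hE := H.E R (hRT.trans hTX) (hsubc R hRT _ h3) t0 ht0R a (hTX haT) t (hTX ht)
          t (hTX ht) z hzX hRa hRt hRt (fun w hw => hzT w (hRT hw)) hat (hzT t ht)
        apply e_inj
        intro d
        have h1 := congrFun hE d
        simp only [Pi.add_apply] at h1
        rw [F_e (Ne.symm ha.1), F_e htt, F_e (hzT t ht).ne, F_e (hzT t0 ht0).ne, F_e hat.ne,
          hTm t0 ht0 a haT (Ne.symm ha.1), hTm a haT t ht ha.2] at h1
        linarith
      refine ⟨f s(t0, z), ?_, hall⟩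
      intro hk
      apply hnotU z hz
      intro Q2 h1 h2 d
      have hm2 : Mono f (insert z T) c := by
        intro u hu a ha hua
        rcases mem_insert.1 hu with rfl | hu2
        · rcases mem_insert.1 ha with rfl | ha
          · exact absurd rfl hua
          · rw [Sym2.eq_swap, hall a ha, hk]
        · rcases mem_insert.1 ha with rfl | ha
          · rw [hall u hu2, hk]
          · exact hTm u hu2 a ha hua
      rw [(hm2.sub h1).S, h2, hSQ]; push_cast; ring
    have hE0c : E0.card ≤ D := by
      refine le_trans (card_le_card ?_) (H.nn z hzX)
      intro z' hz'
      obtain ⟨hzX', hzT'⟩ := mem_filter.1 hz'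
      refine mem_filter.2 ⟨hzX', fun hzz => ?_⟩
      obtain ⟨k, hk, hk1⟩ := hstar z hz
      obtain ⟨k', hk', hk1'⟩ := hstar z' hz'
      obtain ⟨R, hRT, hRc⟩ := exists_subset_card_eq (s := T) (n := r - 1) (by omega)
      have hdc : 2 ≤ (T \ R).card := by rw [card_sdiff_of_subset hRT]; omega
      obtain ⟨a, ha, b, hb, hab⟩ := one_lt_card.1 (show 1 < (T \ R).card by omega)
      rw [mem_sdiff] at ha hb
      obtain ⟨u, hu⟩ : R.Nonempty := card_pos.1 (by omega)
      have hRa : ∀ w ∈ R, G.Adj w a := fun w hw => hTc (hRT hw) ha.1 (by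
          rintro rfl; exact ha.2 hw)
      have hRb : ∀ w ∈ R, G.Adj w b := fun w hw => hTc (hRT hw) hb.1 (by
          rintro rfl; exact hb.2 hw)
      have hE := H.E R (hRT.trans hTX) (hsubc R hRT _ hRc) u hu z hzX z' hzX' a (hTX ha.1) b
        (hTX hb.1) (fun w hw => hzT w (hRT hw)) (fun w hw => hzT' w (hRT hw)) hRa hRb hzz
        (hTc ha.1 hb.1 hab)
      have h1 := congrFun hE c
      simp only [Pi.add_apply] at h1
      rw [F_e (hzT u (hRT hu)).ne, F_e (hzT' u (hRT hu)).ne, F_e hab, F_e (hRa u hu).ne,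
        F_e (hRb u hu).ne, hk1 u (hRT hu), hk1' u (hRT hu), hTm a ha.1 b hb.1 hab,
        hTm u (hRT hu) a ha.1 (hRa u hu).ne, hTm u (hRT hu) b hb.1 (hRb u hu).ne,
        e_ne hk.symm, e_ne hk'.symm, e_self] at h1
      have := F_nonneg f z z' c
      omega
    have hE0c' : (E0.card : ℤ) ≤ D := by exact_mod_cast hE0c
    have := arith1 (z := (Zs G f X r Q).card) hsZ (by positivity) hbig (by linarith)
    exact_mod_cast this

lemma Hyp.Dstep (H : Hyp G f X r D) (hr : 3 ≤ r) (hSh : Share G f X r) : Dprop G f X r := by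
  intro Q Q' hQ hQ'
  have hbig := H.big
  have h3 : 3 * D ≤ r * D := Nat.mul_le_mul_right D hr
  rcases H.dich hr hSh hQ with h1 | ⟨h1, hb⟩
  · rcases H.dich hr hSh hQ' with h1' | ⟨h1', hb'⟩
    · exact H.Zs_join (by omega) hSh (by omega)
    · exact H.Zs_join (by omega) hSh (by omega)
  · rcases H.dich hr hSh hQ' with h1' | ⟨h1', hb'⟩
    · exact H.Zs_join (by omega) hSh (by omega)
    · have hbb := H.beta_beta (by omega) hSh hb hb'
      obtain ⟨P, i, m, c, -⟩ := hb'
      exact ⟨c, c, fun d => by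
        rw [hbb d]; ring⟩

lemma Dall : ∀ k : ℕ, ∀ X : Finset W, Hyp G f X (k + 2) D → Dprop G f X (k + 2) := by
  intro k
  induction k with
  | zero => intro X H; exact H.D2
  | succ k ih =>
    intro X H
    exact H.Dstep (by omega) (H.share (by omega) fun z hz => ih _ (H.descend (by omega) hz))

lemma Hyp.Dmain (H : Hyp G f X r D) (hr : 2 ≤ r) : Dprop G f X r := by
  obtain ⟨k, rfl⟩ : ∃ k, r = k + 2 := ⟨r - 2, by omega⟩
  exact Dall k X H

end FewColors

namespace FewColors

variable {W : Type} [DecidableEq W] {q : ℕ} {G : SimpleGraph W} [DecidableRel G.Adj]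
  {f : Sym2 W → Fin q} {X : Finset W} {r D : ℕ}

lemma four (hT : ¬ HasKrTemplate G f r) {K : Finset W} (hK : G.IsNClique (r - 2) K)
    {w0 w1 w2 w3 : W} (h0 : ∀ x ∈ K, G.Adj x w0) (h1 : ∀ x ∈ K, G.Adj x w1)
    (h2 : ∀ x ∈ K, G.Adj x w2) (h3 : ∀ x ∈ K, G.Adj x w3)
    (a01 : G.Adj w0 w1) (a12 : G.Adj w1 w2) (a23 : G.Adj w2 w3) (a30 : G.Adj w3 w0)
    (n02 : w0 ≠ w2) (n13 : w1 ≠ w3) (d : Fin q) :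
    F f w0 w1 d + F f w2 w3 d = F f w1 w2 d + F f w3 w0 d := by
  by_contra hcon
  apply hT
  let w : ℕ → W := fun i => match i with
    | 0 => w0 | 1 => w1 | 2 => w2 | _ => w3
  refine ⟨K, 2, w, hK, Or.inl rfl, ?_, ?_, ?_, ?_⟩
  · have := a01.ne
    have := a12.ne
    have := a23.ne
    have := a30.ne
    intro i hi j hj hij
    interval_cases i <;> interval_cases j <;> simp only [w] at hij <;> first | rfl | grind
  · intro i hi
    interval_cases i <;> assumption
  · intro i hi
    interval_cases i <;> assumption
  · intro hm
    apply hcon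
    have := congrArg (fun m : Multiset (Fin q) => (m.map fun c => e c d).sum) hm
    simp [List.range_succ, w] at this
    rw [F_e a01.ne, F_e a12.ne, F_e a23.ne, F_e a30.ne]
    linarith

lemma six (hT : ¬ HasKrTemplate G f r) {K : Finset W} (hK : G.IsNClique (r - 2) K)
    {w0 w1 w2 w3 w4 w5 : W} (h0 : ∀ x ∈ K, G.Adj x w0) (h1 : ∀ x ∈ K, G.Adj x w1)
    (h2 : ∀ x ∈ K, G.Adj x w2) (h3 : ∀ x ∈ K, G.Adj x w3) (h4 : ∀ x ∈ K, G.Adj x w4)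
    (h5 : ∀ x ∈ K, G.Adj x w5)
    (a01 : G.Adj w0 w1) (a12 : G.Adj w1 w2) (a23 : G.Adj w2 w3) (a34 : G.Adj w3 w4)
    (a45 : G.Adj w4 w5) (a50 : G.Adj w5 w0)
    (n02 : w0 ≠ w2) (n03 : w0 ≠ w3) (n04 : w0 ≠ w4) (n13 : w1 ≠ w3) (n14 : w1 ≠ w4) (n15 : w1 ≠ w5)
    (n24 : w2 ≠ w4) (n25 : w2 ≠ w5) (n35 : w3 ≠ w5) (d : Fin q) :
    F f w0 w1 d + F f w2 w3 d + F f w4 w5 d = F f w1 w2 d + F f w3 w4 d + F f w5 w0 d := by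
  by_contra hcon
  apply hT
  let w : ℕ → W := fun i => match i with
    | 0 => w0 | 1 => w1 | 2 => w2 | 3 => w3 | 4 => w4 | _ => w5
  refine ⟨K, 3, w, hK, Or.inr rfl, ?_, ?_, ?_, ?_⟩
  · have := a01.ne
    have := a12.ne
    have := a23.ne
    have := a34.ne
    have := a45.ne
    have := a50.ne
    intro i hi j hj hij
    interval_cases i <;> interval_cases j <;> simp only [w] at hij <;> first | rfl | grind
  · intro i hi
    interval_cases i <;> assumption
  · intro i hi
    interval_cases i <;> assumption
  · intro hm
    apply hcon
    have := congrArg (fun m : Multiset (Fin q) => (m.map fun c => e c d).sum) hm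
    simp [List.range_succ, w] at this
    rw [F_e a01.ne, F_e a12.ne, F_e a23.ne, F_e a34.ne, F_e a45.ne, F_e a50.ne]
    linarith

lemma many_common [Fintype W] (hnn : ∀ v, (univ.filter fun w => ¬ G.Adj v w).card ≤ D)
    {T B : Finset W} (h : T.card * D + B.card < Fintype.card W) :
    ∃ z, z ∉ B ∧ ∀ t ∈ T, G.Adj t z := by
  by_contra hcon
  push Not at hcon
  have hsub : (univ : Finset W) ⊆ B ∪ T.biUnion fun t => univ.filter fun w => ¬ G.Adj t w := by
    intro z _
    by_cases hz : z ∈ B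
    · exact mem_union_left _ hz
    obtain ⟨t, ht, h⟩ := hcon z hz
    apply mem_union_right
    simp only [mem_biUnion, mem_filter]
    exact ⟨t, ht, mem_univ z, h⟩
  have h1 := card_le_card hsub
  have h0 := card_union_le B (T.biUnion fun t => univ.filter fun w => ¬ G.Adj t w)
  have h2 : (T.biUnion fun t => univ.filter fun w => ¬ G.Adj t w).card ≤ T.card * D :=
    card_biUnion_le_card_mul _ _ _ fun t ht => hnn t
  rw [card_univ] at h1
  omega

lemma hyp_of_noTemplate [Fintype W] (hr : 3 ≤ r) (hT : ¬ HasKrTemplate G f r)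
    (hnn : ∀ v, (univ.filter fun w => ¬ G.Adj v w).card ≤ D)
    (hbig : r * D + 3 * r ≤ Fintype.card W) : Hyp G f univ r D where
  nn v _ := hnn v
  big := by rw [card_univ]; omega
  E R _ hRc u hu a _ b _ a' _ b' _ ha hb ha' hb' hab hab' := by
    have hK : G.IsNClique (r - 2) (R.erase u) := by
      refine ⟨hRc.isClique.subset (by exact_mod_cast erase_subset u R), ?_⟩
      rw [card_erase_of_mem hu, hRc.card_eq]; omega
    have hKu : ∀ x ∈ R.erase u, G.Adj x u := fun x hx =>
      hRc.isClique (mem_of_mem_erase hx) hu (ne_of_mem_erase hx)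
    have hres : ∀ {a}, (∀ w ∈ R, G.Adj w a) → ∀ x ∈ R.erase u, G.Adj x a := fun h x hx =>
      h x (mem_of_mem_erase hx)
    -- the 4-cycle case
    have key : ∀ {a b b' : W}, (∀ w ∈ R, G.Adj w a) → (∀ w ∈ R, G.Adj w b) →
        (∀ w ∈ R, G.Adj w b') → G.Adj a b → G.Adj a b' → ∀ d,
        F f u b d + F f a b' d = F f u b' d + F f a b d := by
      intro a b b' ha hb hb' hab hab' d
      by_cases hbb : b = b'
      · rw [hbb]
      · have := four hT hK hKu (hres hb) (hres ha) (hres hb') (hb u hu) hab.symm hab' (hb' u hu).symm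
          (ha u hu).ne hbb d
        rw [F_comm f b a, F_comm f b' u] at this
        linarith
    funext d
    simp only [Pi.add_apply]
    by_cases e1 : a = a'
    · subst e1
      have := key ha hb hb' hab hab' d
      linarith
    by_cases e2 : a = b'
    · subst e2
      have := key ha hb ha' hab hab'.symm d
      rw [F_comm f a' a]
      linarith
    by_cases e3 : b = a'
    · subst e3
      have := key hb ha hb' hab.symm hab' d
      rw [F_comm f a b]
      linarith
    by_cases e4 : b = b'
    · subst e4
      have := key hb ha ha' hab.symm hab'.symm d
      rw [F_comm f a b, F_comm f a' b]
      linarith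
    obtain ⟨v, hv, hva⟩ := many_common (G := G) (D := D) hnn (T := insert b (insert a' (R.erase u)))
      (B := {a, b', u}) (by
        have c1 := card_insert_le b (insert a' (R.erase u))
        have c2 := card_insert_le a' (R.erase u)
        have c3 : ({a, b', u} : Finset W).card ≤ 3 := card_le_three
        rw [hK.card_eq] at c2
        have c4 : (insert b (insert a' (R.erase u))).card ≤ r := by omega
        have := Nat.mul_le_mul_right D c4
        omega)
    simp only [mem_insert, mem_singleton, not_or] at hv
    have hvb := hva b (by simp)
    have hva' := hva a' (by simp)
    have hvK : ∀ x ∈ R.erase u, G.Adj x v := fun x hx => hva x (by simp only [mem_insert]; tauto)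
    have s := six hT hK (hres ha) (hres hb) hvK (hres ha') (hres hb') hKu hab hvb hva'.symm hab'
      (hb' u hu).symm (ha u hu) (Ne.symm hv.1) e1 e2 e3 e4 (hb u hu).ne.symm hv.2.1 hv.2.2
      (ha' u hu).ne.symm d
    have t := four hT hK (hres hb) hKu (hres ha') hvK (hb u hu).symm (ha' u hu) hva' hvb.symm
      e3 (Ne.symm hv.2.2) d
    rw [F_comm f v a', F_comm f b' u] at s
    rw [F_comm f b u, F_comm f v b] at t
    linarith

end FewColors

namespace FewColors

variable {W : Type} [DecidableEq W] {q : ℕ} {G : SimpleGraph W} [DecidableRel G.Adj]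
  {f : Sym2 W → Fin q} {X : Finset W} {r D : ℕ}

lemma count_colors {σ : Fin q → ℤ} (h0 : ∀ d, 0 ≤ σ d) {C : Finset (Fin q)} (hC : ∀ d ∈ C, 2 ≤ σ d)
    (hr : 1 ≤ r) (hs : ∑ d, σ d ≤ r * (r - 1)) : C.card ≤ r * (r - 1) / 2 := by
  have h1 : (C.card : ℤ) * 2 ≤ ∑ d, σ d := by
    rw [← nsmul_eq_mul]
    exact (card_nsmul_le_sum _ _ _ hC).trans
      (sum_le_sum_of_subset_of_nonneg (subset_univ _) fun i _ _ => h0 i)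
  have h2 : ((C.card * 2 : ℕ) : ℤ) ≤ ((r * (r - 1) : ℕ) : ℤ) := by
    push_cast [hr]; linarith
  have h3 : C.card * 2 ≤ r * (r - 1) := by exact_mod_cast h2
  omega

/-- the conclusion of the theorem -/
def Concl [Fintype W] (G : SimpleGraph W) [DecidableRel G.Adj] (f : Sym2 W → Fin q) (r : ℕ) : Prop :=
  ∃ U : Finset W, G.minDegree ≤ U.card ∧
      (Finset.univ.filter fun c : Fin q =>
        ∃ u ∈ U, ∃ v ∈ U, G.Adj u v ∧ f s(u, v) = c).card ≤ r * (r - 1) / 2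

lemma concl_of_univ [Fintype W] [Nonempty W] (h : (Finset.univ.filter fun c : Fin q =>
        ∃ u, ∃ v, G.Adj u v ∧ f s(u, v) = c).card ≤ r * (r - 1) / 2) : Concl G f r := by
  refine ⟨univ, ?_, by simpa using h⟩
  obtain ⟨v⟩ := ‹Nonempty W›
  refine (G.minDegree_le_degree v).trans ?_
  exact card_le_card (subset_univ _)

lemma Hyp.good [Fintype W] (H : Hyp G f univ r D) (hr : 2 ≤ r) (v : W)
    (h : ∀ Q Q', CQ G univ r Q → CQ G univ r Q' → v ∈ Q → v ∈ Q' → ∀ d, S f Q d = S f Q' d) :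
    Concl G f r := by
  have hv1 : G.IsNClique 1 {v} := by simp [SimpleGraph.isNClique_iff]
  obtain ⟨Q0, hQ0s, hQ0⟩ := H.extend' (subset_univ _) hv1 (by omega)
  have hv0 : v ∈ Q0 := hQ0s (by simp)
  refine ⟨G.neighborFinset v, by simpa using G.minDegree_le_degree v, ?_⟩
  apply count_colors (S_nonneg f (Q0.erase v)) _ (by omega)
  · rw [S_sum, (hQ0.erase hv0).card_eq]
  · intro c hc
    obtain ⟨-, x, hx, y, hy, hxy, rfl⟩ := mem_filter.1 hc
    rw [SimpleGraph.mem_neighborFinset] at hx hy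
    have h2 : G.IsNClique (1 + 1) (insert x {v}) := isNClique_insert hv1 (by simpa using hx)
    have h3 : G.IsNClique (1 + 1 + 1) (insert y (insert x {v})) := isNClique_insert h2 (by
      simp only [mem_insert, mem_singleton]
      rintro t (rfl | rfl)
      · exact hxy
      · exact hy)
    obtain ⟨Q, hQs, hQ⟩ := H.extend' (subset_univ _) h3 (by omega)
    have hvQ : v ∈ Q := hQs (by simp)
    have hxQ : x ∈ Q := hQs (by simp)
    have hyQ : y ∈ Q := hQs (by simp)
    have e1 := h Q Q0 hQ hQ0 hvQ hv0 (f s(x, y))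
    have e2 := H.phi hr hQ hQ0 hvQ hv0 (f s(x, y))
    rw [e1, sub_self] at e2
    have e3 : dg f Q v (f s(x, y)) - dg f Q0 v (f s(x, y)) = 0 := by
      rcases mul_eq_zero.1 e2 with h | h
      · exfalso; omega
      · exact h
    have e4 := S_er (f := f) hvQ (f s(x, y))
    have e5 := S_er (f := f) hv0 (f s(x, y))
    have e6 := S_color f (mem_erase.2 ⟨hx.ne.symm, hxQ⟩) (mem_erase.2 ⟨hy.ne.symm, hyQ⟩) hxy.ne
    linarith

lemma Hyp.present [Fintype W] (H : Hyp G f univ r D) (hr : 2 ≤ r) {c : Fin q}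
    (hc : ∃ u, ∃ v, G.Adj u v ∧ f s(u, v) = c) : ∃ Q, CQ G univ r Q ∧ 2 ≤ S f Q c := by
  obtain ⟨u, v, huv, rfl⟩ := hc
  have hv1 : G.IsNClique 1 {u} := by simp [SimpleGraph.isNClique_iff]
  have h2 : G.IsNClique (1 + 1) (insert v {u}) := isNClique_insert hv1 (by simpa using huv)
  obtain ⟨Q, hQs, hQ⟩ := H.extend' (subset_univ _) h2 (by omega)
  exact ⟨Q, hQ, S_color f (hQs (by simp)) (hQs (by simp)) huv.ne⟩

lemma cancel2r {r : ℕ} (hr : 2 ≤ r) {x y : ℤ} (h : 2 * (r : ℤ) * x = 2 * r * y) : x = y := by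
  have : (2 * (r : ℤ)) ≠ 0 := by omega
  exact mul_left_cancel₀ this h

/-- three representations force a standard basis vector -/
lemma three_rep {t : Fin q → ℤ} {a b y x1 y1 x2 y2 x3 y3 : Fin q} (hab : a ≠ b) (hya : y ≠ a)
    (hyb : y ≠ b) (h1 : ∀ d, t d = e b d + e y1 d - e x1 d) (h2 : ∀ d, t d = e a d + e y2 d - e x2 d)
    (h3 : ∀ d, t d = e y d + e y3 d - e x3 d) : ∃ w, ∀ d, t d = e w d := by
  by_cases g1 : x1 = b
  · exact ⟨y1, fun d => by rw [h1, g1]; ring⟩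
  by_cases g2 : x1 = y1
  · exact ⟨b, fun d => by rw [h1, g2]; ring⟩
  exfalso
  have k1 := h1 x1
  rw [e_self, e_ne g1, e_ne g2] at k1
  have hx2 : x1 = x2 := by
    by_contra hne
    have := h2 x1
    rw [e_ne hne] at this
    have := e_nonneg a x1
    have := e_nonneg y2 x1
    omega
  have hx3 : x1 = x3 := by
    by_contra hne
    have := h3 x1
    rw [e_ne hne] at this
    have := e_nonneg y x1
    have := e_nonneg y3 x1
    omega
  subst hx2
  subst hx3
  have hy1 : a = y1 := by
    by_contra hne
    have p1 := h1 a
    have p2 := h2 a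
    rw [e_ne hab, e_ne hne] at p1
    rw [e_self] at p2
    have := e_nonneg y2 a
    omega
  have hy2 : y = y1 := by
    by_contra hne
    have p1 := h1 y
    have p2 := h3 y
    rw [e_ne hyb, e_ne hne] at p1
    rw [e_self] at p2
    have := e_nonneg y3 y
    omega
  exact hya (hy2.trans hy1.symm)

lemma Hyp.finish_star [Fintype W] [Nonempty W] (H : Hyp G f univ r D) (hr : 3 ≤ r)
    {μ : Fin q → ℤ} (h0 : ∀ d, 0 ≤ μ d) (hev : ∀ d, Even (μ d))
    (hsum : ∑ d, μ d = r * (r - 1))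
    (hall : ∀ Q, CQ G univ r Q → ∃ c, ∀ d, S f Q d = μ d + 2 * r * e c d) : Concl G f r := by
  by_cases hex : ∃ Q c, CQ G univ r Q ∧ (∀ d, S f Q d = μ d + 2 * r * e c d) ∧ μ c = 0
  · obtain ⟨Q, c, hQ, hS, hc⟩ := hex
    have hv : ∃ v ∈ Q, 2 ≤ dg f Q v c := by
      by_contra hcon
      push Not at hcon
      have h1 : S f Q c ≤ Q.card := by
        unfold S
        rw [Finset.sum_apply]
        calc ∑ v ∈ Q, dg f Q v c ≤ ∑ v ∈ Q, (1 : ℤ) := sum_le_sum fun v hv => by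
              have := hcon v hv; omega
          _ = Q.card := by simp
      rw [hS, hc, e_self, hQ.2.card_eq] at h1
      push_cast at h1
      omega
    obtain ⟨v, hvQ, hv2⟩ := hv
    have key : ∀ Q', CQ G univ r Q' → v ∈ Q' → ∀ d, S f Q' d = S f Q d := by
      intro Q' hQ' hvQ' d
      obtain ⟨c', hc'⟩ := hall Q' hQ'
      by_cases hcc : c = c'
      · rw [hc', hS, hcc]
      · exfalso
        have h1 := H.phi (by omega) hQ hQ' hvQ hvQ' c
        have h2 := hc' c
        rw [e_ne hcc, hc] at h2
        have h3 := dg_le_S f Q' hvQ' c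
        have h4 : dg f Q v c - dg f Q' v c = 1 := by
          apply cancel2r (r := r) (by omega)
          rw [h1, hS, h2, hc, e_self]; ring
        linarith
    apply H.good (by omega) v
    intro Q1 Q2 h1 h2 h3 h4 d
    rw [key Q1 h1 h3, key Q2 h2 h4]
  · push Not at hex
    apply concl_of_univ
    apply count_colors h0 _ (by omega) hsum.le
    intro d hd
    obtain ⟨Q, hQ, hQd⟩ := H.present (by omega) (mem_filter.1 hd).2
    obtain ⟨c, hc⟩ := hall Q hQ
    by_cases hdc : d = c
    · subst hdc
      have h1 := hex Q d hQ hc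
      have h2 := h0 d
      obtain ⟨k, hk⟩ := hev d
      omega
    · rw [hc, e_ne hdc] at hQd
      linarith

lemma Hyp.finish [Fintype W] [Nonempty W] (H : Hyp G f univ r D) (hr : 3 ≤ r) : Concl G f r := by
  have hD := H.Dmain (by omega)
  by_cases hall : ∀ Q Q', CQ G univ r Q → CQ G univ r Q' → ∀ d, S f Q d = S f Q' d
  · obtain ⟨v⟩ := ‹Nonempty W›
    exact H.good (by omega) v fun Q Q' h h' _ _ => hall Q Q' h h'
  push Not at hall
  obtain ⟨Q1, Q2, hQ1, hQ2, d0, hne⟩ := hall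
  obtain ⟨a, b, hab'⟩ := hD Q1 Q2 hQ1 hQ2
  have hab : a ≠ b := by
    rintro rfl
    have := hab' d0
    apply hne; linarith
  have hr2 : (2 : ℤ) ≤ r := by omega
  obtain ⟨μ, hμ⟩ : ∃ μ : Fin q → ℤ, ∀ d, μ d = S f Q1 d - 2 * r * e a d := ⟨_, fun d => rfl⟩
  have hS1 : ∀ d, S f Q1 d = μ d + 2 * r * e a d := fun d => by rw [hμ]; ring
  have hS2 : ∀ d, S f Q2 d = μ d + 2 * r * e b d := fun d => by
    have := hab' d; rw [hμ]; linarith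
  have hsum : ∑ d, μ d = r * (r - 1) := by
    have h1 := S_sum f Q1
    rw [sum_congr rfl fun d _ => hS1 d, sum_add_distrib, ← mul_sum, e_sum, hQ1.2.card_eq] at h1
    push_cast at h1
    linarith
  have h0 : ∀ d, 0 ≤ μ d := by
    intro d
    by_cases hda : d = a
    · have := S_nonneg f Q2 d
      rw [hS2, e_ne (by rw [hda]; exact hab)] at this
      linarith
    · have := S_nonneg f Q1 d
      rw [hS1, e_ne hda] at this
      linarith
  by_cases hstar : ∀ Q, CQ G univ r Q → ∃ c, ∀ d, S f Q d = μ d + 2 * r * e c d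
  · refine H.finish_star hr h0 (fun d => ?_) hsum hstar
    rw [hμ]
    apply (S_mono_even f Q1 d).sub
    rw [mul_assoc]; exact even_two_mul _
  push Not at hstar
  obtain ⟨Q3, hQ3, h3⟩ := hstar
  obtain ⟨x, y, hxy⟩ := hD Q3 Q1 hQ3 hQ1
  obtain ⟨x', y', hxy'⟩ := hD Q3 Q2 hQ3 hQ2
  have hya : y ≠ a := by
    intro hh
    obtain ⟨d, hd⟩ := h3 x
    apply hd
    have := hxy d
    rw [hS1, hh] at this; linarith
  have hyx : y ≠ x := by
    intro hh
    obtain ⟨d, hd⟩ := h3 a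
    apply hd
    have := hxy d
    rw [hS1, hh] at this; linarith
  have hyb' : y' ≠ b := by
    intro hh
    obtain ⟨d, hd⟩ := h3 x'
    apply hd
    have := hxy' d
    rw [hS2, hh] at this; linarith
  have heq : ∀ d, e a d + e x d + e y' d = e b d + e x' d + e y d := by
    intro d
    apply cancel2r (r := r) (by omega)
    have k1 := hxy d
    have k2 := hxy' d
    rw [hS1] at k1
    rw [hS2] at k2
    linarith
  have hyy : y = y' := by
    by_contra hh
    have := heq y
    rw [e_ne hya, e_ne hyx, e_ne hh, e_self] at this
    have := e_nonneg b y
    have := e_nonneg x' y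
    omega
  have hxb : b = x := by
    by_contra hh
    have := heq b
    rw [e_ne hab.symm, e_ne hh, hyy, e_self] at this
    have := e_nonneg x' b
    omega
  have hyb : y ≠ b := by rw [hyy]; exact hyb'
  have hS3 : ∀ d, S f Q3 d = μ d + 2 * r * (e a d + e b d - e y d) := by
    intro d
    have := hxy d
    rw [hS1, ← hxb] at this; linarith
  obtain ⟨ν, hν⟩ : ∃ ν : Fin q → ℤ, ∀ d, ν d = μ d + 2 * r * (e a d + e b d) := ⟨_, fun d => rfl⟩
  have hν0 : ∀ d, 0 ≤ ν d := by
    intro d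
    rw [hν]
    have := h0 d
    have := e_nonneg a d
    have := e_nonneg b d
    positivity
  have hrep : ∀ Q, CQ G univ r Q → ∃ w, ∀ d, S f Q d = ν d - 2 * r * e w d := by
    intro Q hQ
    obtain ⟨x1, y1, k1⟩ := hD Q Q1 hQ hQ1
    obtain ⟨x2, y2, k2⟩ := hD Q Q2 hQ hQ2
    obtain ⟨x3, y3, k3⟩ := hD Q Q3 hQ hQ3
    obtain ⟨w, hw⟩ := three_rep (t := fun d => e b d + e y1 d - e x1 d) hab hya hyb
      (x1 := x1) (y1 := y1) (x2 := x2) (y2 := y2) (x3 := x3) (y3 := y3) (fun d => rfl)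
      (fun d => by
        apply cancel2r (r := r) (by omega)
        have g1 := k1 d
        have g2 := k2 d
        rw [hS1] at g1
        rw [hS2] at g2
        linarith)
      (fun d => by
        apply cancel2r (r := r) (by omega)
        have g1 := k1 d
        have g3 := k3 d
        rw [hS1] at g1
        rw [hS3] at g3
        linarith)
    refine ⟨w, fun d => ?_⟩
    rw [← hw d, hν]
    have g1 := k1 d
    rw [hS1] at g1
    linarith
  have hνa : 2 * (r : ℤ) ≤ ν a := by
    have := S_nonneg f Q2 a
    rw [hS2, e_ne hab] at this
    rw [hν, e_self, e_ne hab]; linarith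
  have hνb : 2 * (r : ℤ) ≤ ν b := by
    have := S_nonneg f Q1 b
    rw [hS1, e_ne hab.symm] at this
    rw [hν, e_self, e_ne hab.symm]; linarith
  have hνy : 2 * (r : ℤ) ≤ ν y := by
    have := S_nonneg f Q3 y
    rw [hS3, e_self, e_ne hya, e_ne hyb] at this
    rw [hν, e_ne hya, e_ne hyb]; linarith
  apply concl_of_univ
  have hbound : ∀ d, ∀ k : ℤ, k ≤ 2 → k ≤ ν d →
      k ≤ ν d - (2 * r - 2) * (e a d + e b d + e y d) := by
    intro d k hk hkd
    by_cases g1 : d = a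
    · rw [g1, e_self, e_ne hab, e_ne hya.symm]; linarith
    by_cases g2 : d = b
    · rw [g2, e_self, e_ne hab.symm, e_ne hyb.symm]; linarith
    by_cases g3 : d = y
    · rw [g3, e_self, e_ne hya, e_ne hyb]; linarith
    rw [e_ne g1, e_ne g2, e_ne g3]; linarith
  apply count_colors (σ := fun d => ν d - (2 * r - 2) * (e a d + e b d + e y d))
    (fun d => hbound d 0 (by norm_num) (hν0 d)) _ (by omega)
  · rw [sum_sub_distrib, ← mul_sum, sum_add_distrib, sum_add_distrib, e_sum, e_sum, e_sum,
      sum_congr rfl fun d _ => hν d, sum_add_distrib, ← mul_sum, sum_add_distrib, e_sum, e_sum, hsum]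
    have : (3 : ℤ) ≤ r := by exact_mod_cast hr
    linarith
  · intro d hd
    obtain ⟨Q, hQ, hQd⟩ := H.present (by omega) (mem_filter.1 hd).2
    obtain ⟨w, hw⟩ := hrep Q hQ
    refine hbound d 2 le_rfl ?_
    rw [hw] at hQd
    have := e_nonneg w d
    have : 0 ≤ 2 * (r : ℤ) * e w d := by positivity
    linarith

end FewColors

theorem few_colors_in_large_set (r q : ℕ) (hr : 3 ≤ r)
    {W : Type} [Fintype W] [DecidableEq W]
    (G : SimpleGraph W) [DecidableRel G.Adj] (f : Sym2 W → Fin q)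
    (hδ : ((r : ℝ) - 1) / r * (Fintype.card W) + 3 ≤ G.minDegree)
    (hTemp : ¬ HasKrTemplate G f r) :
    ∃ U : Finset W, G.minDegree ≤ U.card ∧
      (Finset.univ.filter fun c : Fin q =>
        ∃ u ∈ U, ∃ v ∈ U, G.Adj u v ∧ f s(u, v) = c).card ≤ r * (r - 1) / 2 := by
  have hr0 : (0 : ℝ) < r := by exact_mod_cast (by omega : 0 < r)
  have h1 : ((r : ℝ) - 1) * (Fintype.card W) + 3 * r ≤ r * G.minDegree := by
    have := mul_le_mul_of_nonneg_left hδ hr0.le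
    have e1 : (r : ℝ) * (((r : ℝ) - 1) / r * (Fintype.card W) + 3) =
        ((r : ℝ) - 1) * (Fintype.card W) + 3 * r := by field_simp
    linarith
  have hne : Nonempty W := by
    by_contra hcon
    rw [not_nonempty_iff] at hcon
    have h2 : G.minDegree = 0 := by simp [SimpleGraph.minDegree]
    rw [h2] at h1
    simp at h1
    linarith
  have hle : G.minDegree ≤ Fintype.card W := by
    obtain ⟨v⟩ := hne
    exact (G.minDegree_le_degree v).trans (card_le_card (subset_univ _))
  have hbig : r * (Fintype.card W - G.minDegree) + 3 * r ≤ Fintype.card W := by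
    have : ((r * (Fintype.card W - G.minDegree) + 3 * r : ℕ) : ℝ) ≤ (Fintype.card W : ℝ) := by
      push_cast [hle]; linarith
    exact_mod_cast this
  have H := FewColors.hyp_of_noTemplate hr hTemp (D := Fintype.card W - G.minDegree) (by
    intro v
    have h2 := card_filter_add_card_filter_not (s := (univ : Finset W)) (G.Adj v)
    have h3 : (univ.filter (G.Adj v)).card = G.degree v := by
      rw [← SimpleGraph.card_neighborFinset_eq_degree, SimpleGraph.neighborFinset_eq_filter]
    have h4 := G.minDegree_le_degree v
    rw [card_univ] at h2
    omega) hbig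
  exact H.finish hr
end

section
/- Let r ≥ 3 and let (G,f) be a q-edge-colored graph with minimum degree δ(G) ≥ (r/(r+1))·|V(G)| + 3 which contains no K_r-template. Then there exists a subset U ⊆ V(G) with |U| ≥ δ(G) such that all edges of the induced subgraph G[U] have the same color. -/
open Finset

variable {V : Type*}

/-- Any set of at most `r + 1` vertices has a common neighbor. -/
lemma exists_common_nbr {W : Type} [Fintype W] [DecidableEq W]
    (G : SimpleGraph W) [DecidableRel G.Adj] (r : ℕ)
    (h : r * Fintype.card W + 3 * (r + 1) ≤ G.minDegree * (r + 1))
    (S : Finset W) (hS : S.card ≤ r + 1) : ∃ v, ∀ s ∈ S, G.Adj s v := by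
  by_contra hcon
  push Not at hcon
  have hcov : (Finset.univ : Finset W) ⊆ S.biUnion fun s => (G.neighborFinset s)ᶜ := by
    intro v _
    obtain ⟨s, hs, hv⟩ := hcon v
    simp only [Finset.mem_biUnion, Finset.mem_compl, SimpleGraph.mem_neighborFinset]
    exact ⟨s, hs, hv⟩
  have h1 := Finset.card_le_card hcov
  have h2 : (S.biUnion fun s => (G.neighborFinset s)ᶜ).card
      ≤ S.card * (Fintype.card W - G.minDegree) := by
    apply Finset.card_biUnion_le_card_mul
    intro s _
    rw [Finset.card_compl, SimpleGraph.card_neighborFinset_eq_degree]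
    have := G.minDegree_le_degree s
    omega
  have h3 : S.card * (Fintype.card W - G.minDegree)
      ≤ (r + 1) * (Fintype.card W - G.minDegree) := Nat.mul_le_mul_right _ hS
  rw [Finset.card_univ] at h1
  rcases Nat.le_total G.minDegree (Fintype.card W) with hle | hle
  · obtain ⟨t, ht⟩ := Nat.exists_eq_add_of_le hle
    rw [ht] at h1 h2 h3 h
    rw [Nat.add_sub_cancel_left] at h2 h3
    nlinarith
  · rw [Nat.sub_eq_zero_of_le hle, mul_zero] at h2
    have h0 : Fintype.card W = 0 := by omega
    have : IsEmpty W := Fintype.card_eq_zero_iff.mp h0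
    have : G.minDegree = 0 := by simp
    rw [this] at h
    omega

/-- Common neighborhoods of small sets contain cliques. -/
lemma exists_clique_common {W : Type} [Fintype W] [DecidableEq W]
    (G : SimpleGraph W) [DecidableRel G.Adj] (r : ℕ)
    (h : r * Fintype.card W + 3 * (r + 1) ≤ G.minDegree * (r + 1))
    (S : Finset W) (k : ℕ) (hS : S.card + k ≤ r + 2) :
    ∃ K : Finset W, G.IsNClique k K ∧ ∀ s ∈ S, ∀ x ∈ K, G.Adj x s := by
  induction k with
  | zero => exact ⟨∅, by simp, by simp⟩
  | succ k ih =>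
    obtain ⟨K, hK, hadj⟩ := ih (by omega)
    obtain ⟨v, hv⟩ := exists_common_nbr G r h (S ∪ K) (by
      have := Finset.card_union_le S K
      have := hK.card_eq
      omega)
    refine ⟨insert v K, hK.insert fun b hb => (hv b (by simp [hb])).symm, ?_⟩
    intro s hs x hx
    rcases Finset.mem_insert.mp hx with rfl | hx
    · exact (hv s (by simp [hs])).symm
    · exact hadj s hs x hx

/-- Every 4-cycle of `G` on a clique is balanced. -/
lemma k4_balanced {W : Type} [Fintype W] [DecidableEq W]
    (G : SimpleGraph W) [DecidableRel G.Adj] (r q : ℕ) (hr : 3 ≤ r) (f : Sym2 W → Fin q)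
    (h : r * Fintype.card W + 3 * (r + 1) ≤ G.minDegree * (r + 1))
    (hTemp : ¬ HasKrTemplate G f r) (a b c d : W)
    (hab : G.Adj a b) (hac : G.Adj a c) (had : G.Adj a d) (hbc : G.Adj b c)
    (hbd : G.Adj b d) (hcd : G.Adj c d) :
    (f s(a, b) = f s(b, c) ∧ f s(c, d) = f s(a, d)) ∨
      (f s(a, b) = f s(a, d) ∧ f s(c, d) = f s(b, c)) := by
  obtain ⟨K, hK, hadj⟩ := exists_clique_common G r h {a, b, c, d} (r - 2) (by
    have : ({a, b, c, d} : Finset W).card ≤ 4 := Finset.card_le_four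
    omega)
  by_contra hne
  apply hTemp
  let w : ℕ → W := fun i => if i = 0 then a else if i = 1 then b else if i = 2 then c else d
  have w0 : w 0 = a := rfl
  have w1 : w 1 = b := rfl
  have w2 : w 2 = c := rfl
  have w3 : w 3 = d := rfl
  refine ⟨K, 2, w, hK, Or.inl rfl, ?_, ?_, ?_, ?_⟩
  · intro i hi j hj hij
    have := hab.ne
    have := hac.ne
    have := had.ne
    have := hbc.ne
    have := hbd.ne
    have := hcd.ne
    interval_cases i <;> interval_cases j <;> simp_all
  · intro i hi x hx
    apply hadj _ _ x hx
    interval_cases i <;> simp [w0, w1, w2, w3]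
  · intro i hi
    interval_cases i <;> simp [w0, w1, w2, w3, *]
    exact had.symm
  · intro heq
    apply hne
    have heq' : [f s(a, b), f s(c, d)].Perm [f s(b, c), f s(a, d)] := by
      rw [Sym2.eq_swap (a := a) (b := d)]
      simpa [List.range_succ, w0, w1, w2, w3] using heq
    have hm : f s(a, b) ∈ [f s(b, c), f s(a, d)] := heq'.subset (by simp)
    simp only [List.mem_cons, List.not_mem_nil, or_false] at hm
    rcases hm with hm | hm
    · rw [hm, List.perm_cons] at heq'
      exact Or.inl ⟨hm, by simpa using heq'⟩
    · have h2 := heq'.trans (List.Perm.swap _ _ _)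
      rw [hm, List.perm_cons] at h2
      exact Or.inr ⟨hm, by simpa using h2⟩

/-- **Lemma.** Let `r ≥ 3` and let `(G, f)` be a `q`-edge-colored graph with
`δ(G) ≥ (r/(r+1))|V(G)| + 3` and no `K_r`-template.  Then there is `U ⊆ V(G)` with
`|U| ≥ δ(G)` such that all edges inside `U` have the same color. -/
theorem monochromatic_large_set (r q : ℕ) (hr : 3 ≤ r)
    {W : Type} [Fintype W] [DecidableEq W]
    (G : SimpleGraph W) [DecidableRel G.Adj] (f : Sym2 W → Fin q)
    (hδ : (r : ℝ) / (r + 1) * (Fintype.card W) + 3 ≤ G.minDegree)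
    (hTemp : ¬ HasKrTemplate G f r) :
    ∃ U : Finset W, G.minDegree ≤ U.card ∧
      ∀ u ∈ U, ∀ v ∈ U, ∀ u' ∈ U, ∀ v' ∈ U,
        G.Adj u v → G.Adj u' v' → f s(u, v) = f s(u', v') := by
  have h : r * Fintype.card W + 3 * (r + 1) ≤ G.minDegree * (r + 1) := by
    have hpos : (0 : ℝ) < r + 1 := by positivity
    have h1 : ((r : ℝ) / (r + 1) * (Fintype.card W) + 3) * (r + 1) ≤ G.minDegree * (r + 1) :=
      mul_le_mul_of_nonneg_right hδ hpos.le
    have h2 : ((r : ℝ) / (r + 1) * (Fintype.card W) + 3) * (r + 1)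
        = r * Fintype.card W + 3 * (r + 1) := by
      field_simp
    rw [h2] at h1
    exact_mod_cast h1
  have K4 := k4_balanced G r q hr f h hTemp
  have C3 : ∀ a b c : W, ∃ v, G.Adj a v ∧ G.Adj b v ∧ G.Adj c v := by
    intro a b c
    obtain ⟨v, hv⟩ := exists_common_nbr G r h {a, b, c} (by
      have : ({a, b, c} : Finset W).card ≤ 3 := Finset.card_le_three
      omega)
    exact ⟨v, hv a (by simp), hv b (by simp), hv c (by simp)⟩
  have C4 : ∀ a b c d : W, ∃ v, G.Adj a v ∧ G.Adj b v ∧ G.Adj c v ∧ G.Adj d v := by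
    intro a b c d
    obtain ⟨v, hv⟩ := exists_common_nbr G r h {a, b, c, d} (by
      have : ({a, b, c, d} : Finset W).card ≤ 4 := Finset.card_le_four
      omega)
    exact ⟨v, hv a (by simp), hv b (by simp), hv c (by simp), hv d (by simp)⟩
  have hsw : ∀ u v : W, f s(u, v) = f s(v, u) := fun u v => by rw [Sym2.eq_swap]
  suffices hs : ∃ a : W, ∀ u v u' v', G.Adj a u → G.Adj a v → G.Adj a u' → G.Adj a v' →
      G.Adj u v → G.Adj u' v' → f s(u, v) = f s(u', v') by
    obtain ⟨a, ha⟩ := hs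
    refine ⟨G.neighborFinset a, ?_, ?_⟩
    · rw [SimpleGraph.card_neighborFinset_eq_degree]
      exact G.minDegree_le_degree a
    · intro u hu v hv u' hu' v' hv'
      simp only [SimpleGraph.mem_neighborFinset] at hu hv hu' hv'
      exact ha u v u' v' hu hv hu' hv'
  by_cases hmono : ∀ a b c, G.Adj a b → G.Adj a c → G.Adj b c → f s(a, b) = f s(a, c)
  · obtain ⟨a, -⟩ := exists_common_nbr G r h ∅ (by simp)
    refine ⟨a, fun u v u' v' hu hv hu' hv' huv huv' => ?_⟩
    obtain ⟨g, hag, hug, hug'⟩ := C3 a u u'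
    have e1 := hmono u v a huv hu.symm hv.symm
    have e2 := hmono u' v' a huv' hu'.symm hv'.symm
    have e3 := hmono a u g hu hag hug
    have e4 := hmono a u' g hu' hag hug'
    rw [e1, e2, hsw u a, hsw u' a, e3, e4]
  · -- an apex of a non-monochromatic triangle
    have hapex : ∃ a b c, G.Adj a b ∧ G.Adj a c ∧ G.Adj b c ∧ f s(a, b) = f s(a, c) ∧
        f s(b, c) ≠ f s(a, b) := by
      push Not at hmono
      obtain ⟨a, b, c, hab, hac, hbc, hne⟩ := hmono
      by_cases h1 : f s(b, c) = f s(a, b)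
      · exact ⟨b, a, c, hab.symm, hbc, hac, by rw [hsw b a, h1], by rw [hsw b a]; exact hne.symm⟩
      by_cases h2 : f s(b, c) = f s(a, c)
      · exact ⟨c, a, b, hac.symm, hbc.symm, hab, by rw [hsw c a, hsw c b, h2],
          by rw [hsw c a]; exact hne⟩
      exfalso
      obtain ⟨d, had, hbd, hcd⟩ := C3 a b c
      have e1 := K4 a b c d hab hac had hbc hbd hcd
      have e2 := K4 a c b d hac hab had hbc.symm hcd hbd
      rw [hsw c b] at e2
      grind
    obtain ⟨a, b, c, hab, hac, hbc, hx, hy⟩ := hapex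
    have step : ∀ b c d, G.Adj a b → G.Adj a c → G.Adj a d → G.Adj b c → G.Adj b d → G.Adj c d →
        f s(a, b) = f s(a, c) → f s(b, c) ≠ f s(a, b) →
        f s(a, b) = f s(a, d) ∧ f s(b, d) = f s(b, c) := by
      intro b c d hab hac had hbc hbd hcd hx hy
      have e1 := K4 a b c d hab hac had hbc hbd hcd
      have e2 := K4 a c b d hac hab had hbc.symm hcd hbd
      rw [hsw c b] at e2
      grind
    have step2 : ∀ b c d, G.Adj a b → G.Adj a c → G.Adj a d → G.Adj b c → G.Adj b d →
        f s(a, b) = f s(a, c) → f s(b, c) ≠ f s(a, b) →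
        f s(a, b) = f s(a, d) ∧ f s(b, d) = f s(b, c) := by
      intro b c d hab hac had hbc hbd hx hy
      obtain ⟨e, hae, hbe, hce, hde⟩ := C4 a b c d
      obtain ⟨p1, p2⟩ := step b c e hab hac hae hbc hbe hce hx hy
      obtain ⟨p3, p4⟩ := step b e d hab hae had hbe hbd hde.symm p1 (by rw [p2]; exact hy)
      exact ⟨p3, p4.trans p2⟩
    have key : ∀ d e, G.Adj a d → G.Adj a e → G.Adj d e → f s(d, e) = f s(b, c) := by
      intro d e had hae hde
      obtain ⟨g, hag, hbg, hdg⟩ := C3 a b d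
      obtain ⟨p1, p2⟩ := step2 b c g hab hac hag hbc hbg hx hy
      obtain ⟨p3, p4⟩ := step2 g b d hag hab had hbg.symm hdg.symm p1.symm
        (by rw [hsw g b, p2, ← p1]; exact hy)
      have q1 : f s(g, b) = f s(b, c) := by rw [hsw g b, p2]
      obtain ⟨p5, p6⟩ := step2 d g e had hag hae hdg hde p3.symm
        (by rw [hsw d g, p4, q1, ← p3, ← p1]; exact hy)
      rw [p6, hsw d g, p4, q1]
    exact ⟨a, fun u v u' v' hu hv hu' hv' huv huv' =>
      (key u v hu hv huv).trans (key u' v' hu' hv' huv').symm⟩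
end

section
/- Let r, n be positive integers with r | n, and let V(K_n) = X ⊔ Y be a partition of the vertex set of the complete graph K_n. Let T be a K_r-tiling of K_n that, among all K_r-tilings of K_n, minimizes the number of edges of T with both endpoints in X. Then there exists an integer k ≥ 0 such that every r-clique K ∈ T satisfies |V(K) ∩ X| ∈ {k, k+1}. -/
open Finset

variable {V : Type*}

/-- **Lemma.** Let `r ∣ n` and let `V(K_n) = X ⊔ Y`.  If `T` is a `K_r`-tiling of `K_n`
minimizing the number of edges induced by `X`, then there is `k ≥ 0` such that every clique
`K ∈ T` satisfies `|K ∩ X| ∈ {k, k+1}`. -/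
theorem extremal_tiling_balanced_intersections (r n : ℕ) (hr : 0 < r) (hn : 0 < n)
    (hrn : r ∣ n) (X : Finset (Fin n))
    (T : Finset (Finset (Fin n))) (hT : IsKrTiling (⊤ : SimpleGraph (Fin n)) r T)
    (hmin : ∀ T' : Finset (Finset (Fin n)), IsKrTiling (⊤ : SimpleGraph (Fin n)) r T' →
      ∑ K ∈ T, ((K ∩ X).card).choose 2 ≤ ∑ K ∈ T', ((K ∩ X).card).choose 2) :
    ∃ k : ℕ, ∀ K ∈ T, (K ∩ X).card = k ∨ (K ∩ X).card = k + 1 := by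
  classical
  obtain ⟨hcl, hdis, hun⟩ := hT
  have key : ∀ A ∈ T, ∀ B ∈ T, (A ∩ X).card ≤ (B ∩ X).card + 1 := by
    intro A hA B hB
    by_contra! hlt
    have hAB : A ≠ B := by
      rintro rfl
      omega
    have hd := hdis A hA B hB hAB
    have hAr : A.card = r := (hcl A hA).card_eq
    have hBr : B.card = r := (hcl B hB).card_eq
    obtain ⟨x, hx⟩ : (A ∩ X).Nonempty := by
      rw [← Finset.card_pos]
      omega
    obtain ⟨y, hy⟩ : (B \ X).Nonempty := by
      rw [← Finset.card_pos]
      have h1 := Finset.card_sdiff_add_card_inter B X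
      have h2 : (A ∩ X).card ≤ A.card := Finset.card_le_card Finset.inter_subset_left
      omega
    rw [Finset.mem_inter] at hx
    rw [Finset.mem_sdiff] at hy
    have hxB : x ∉ B := Finset.disjoint_left.mp hd hx.1
    have hyA : y ∉ A := Finset.disjoint_right.mp hd hy.1
    set σ : Equiv.Perm (Fin n) := Equiv.swap x y with hσ
    have hmem : ∀ (K : Finset (Fin n)) z, z ∈ K.map σ.toEmbedding ↔ σ z ∈ K := by
      intro K z
      rw [Finset.mem_map_equiv]
      simp [hσ]
    have htil : IsKrTiling (⊤ : SimpleGraph (Fin n)) r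
        (T.map (Finset.mapEmbedding σ.toEmbedding).toEmbedding) := by
      refine ⟨?_, ?_, ?_⟩
      · intro K hK
        obtain ⟨L, hL, rfl⟩ := Finset.mem_map.mp hK
        refine ⟨fun a _ b _ hab => hab, ?_⟩
        simpa using (hcl L hL).card_eq
      · intro K hK K' hK' hne
        obtain ⟨L, hL, rfl⟩ := Finset.mem_map.mp hK
        obtain ⟨L', hL', rfl⟩ := Finset.mem_map.mp hK'
        have hLL : L ≠ L' := by
          rintro rfl
          exact hne rfl
        simpa using hdis L hL L' hL' hLL
      · ext z
        have hz : σ z ∈ T.biUnion id := by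
          rw [hun]
          exact Finset.mem_univ _
        obtain ⟨L, hL, hzL⟩ := Finset.mem_biUnion.mp hz
        simp only [Finset.mem_univ, iff_true, Finset.mem_biUnion]
        exact ⟨_, Finset.mem_map_of_mem _ hL, (hmem L z).mpr hzL⟩
    have hle := hmin _ htil
    rw [Finset.sum_map] at hle
    have hB' : B ∈ T.erase A := Finset.mem_erase.mpr ⟨hAB.symm, hB⟩
    rw [← Finset.add_sum_erase T _ hA, ← Finset.add_sum_erase T _ hA,
      ← Finset.add_sum_erase _ _ hB', ← Finset.add_sum_erase _ _ hB'] at hle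
    have hrest : ∑ K ∈ (T.erase A).erase B,
        (((Finset.mapEmbedding σ.toEmbedding).toEmbedding K ∩ X).card).choose 2
        = ∑ K ∈ (T.erase A).erase B, ((K ∩ X).card).choose 2 := by
      refine Finset.sum_congr rfl fun K hK => ?_
      simp only [Finset.mem_erase] at hK
      have hxK : x ∉ K := Finset.disjoint_left.mp (hdis A hA K hK.2.2 (Ne.symm hK.2.1)) hx.1
      have hyK : y ∉ K := Finset.disjoint_left.mp (hdis B hB K hK.2.2 (Ne.symm hK.1)) hy.1
      have : (Finset.mapEmbedding σ.toEmbedding).toEmbedding K = K := by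
        ext z
        refine (hmem K z).trans ?_
        rw [hσ, Equiv.swap_apply_def]
        split_ifs <;> simp_all
      rw [this]
    have hA2 : (Finset.mapEmbedding σ.toEmbedding).toEmbedding A ∩ X = (A ∩ X).erase x := by
      ext z
      rw [Finset.mem_inter, Finset.mem_erase, Finset.mem_inter]
      refine (and_congr_left' (hmem A z)).trans ?_
      rw [hσ, Equiv.swap_apply_def]
      split_ifs <;> simp_all
    have hB2 : (Finset.mapEmbedding σ.toEmbedding).toEmbedding B ∩ X = insert x (B ∩ X) := by
      ext z
      rw [Finset.mem_inter, Finset.mem_insert, Finset.mem_inter]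
      refine (and_congr_left' (hmem B z)).trans ?_
      rw [hσ, Equiv.swap_apply_def]
      split_ifs <;> simp_all
    rw [hrest, hA2, hB2, Finset.card_erase_of_mem (Finset.mem_inter.mpr hx),
      Finset.card_insert_of_notMem (fun h => hxB (Finset.mem_inter.mp h).1)] at hle
    obtain ⟨d, hd⟩ := Nat.exists_eq_add_of_lt hlt
    rw [hd, Nat.add_sub_cancel, Nat.choose_succ_succ' _ 1, Nat.choose_succ_succ' (B ∩ X).card 1,
      Nat.choose_one_right, Nat.choose_one_right] at hle
    simp only [Nat.reduceAdd] at hle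
    omega
  rcases T.eq_empty_or_nonempty with rfl | hne
  · exact ⟨0, by simp⟩
  · obtain ⟨B, hB, hBmin⟩ := Finset.exists_min_image T (fun K => (K ∩ X).card) hne
    refine ⟨(B ∩ X).card, fun K hK => ?_⟩
    have h1 := key K hK B hB
    have h2 := hBmin K hK
    omega
end

section
/- Let r ≥ 2, let C ≥ 0, and let G be a graph with minimum degree δ(G) ≥ ((r−1)/r)·|V(G)| + C. Let 1 ≤ t ≤ r−1 and let K be a copy of the complete graph K_t in G. Then the subgraph of G induced on the common neighborhood N(K) = {v ∈ V(G) : vw ∈ E(G) for all w ∈ K} satisfies δ(G[N(K)]) ≥ ((r−t−1)/(r−t))·|N(K)| + C. -/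
open Finset

/-- The common neighborhood `N(K)` of a set of vertices `K`. -/
def commonNbrs {W : Type*} [Fintype W] (G : SimpleGraph W) [DecidableRel G.Adj]
    (K : Finset W) : Finset W :=
  Finset.univ.filter fun v => ∀ x ∈ K, G.Adj x v

/-- **Lemma (minimum degree in the neighborhood of a `K_t`).** Let `r ≥ 2`, `C ≥ 0` and let
`G` satisfy `δ(G) ≥ ((r−1)/r)|V(G)| + C`.  Then for `1 ≤ t ≤ r − 1` and every `t`-clique
`K` of `G`, the graph induced on `N(K)` has minimum degree at least
`((r−t−1)/(r−t))|N(K)| + C`, i.e. every vertex of `N(K)` has at least that many neighbors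
inside `N(K)`. -/
theorem minDegree_in_nbhd_of_clique (r t : ℕ) (hr : 2 ≤ r) (C : ℝ) (hC : 0 ≤ C)
    {W : Type} [Fintype W] [DecidableEq W]
    (G : SimpleGraph W) [DecidableRel G.Adj]
    (hδ : ((r : ℝ) - 1) / r * (Fintype.card W) + C ≤ G.minDegree)
    (ht1 : 1 ≤ t) (ht2 : t ≤ r - 1)
    (K : Finset W) (hK : G.IsNClique t K) :
    ∀ v ∈ commonNbrs G K,
      ((r : ℝ) - t - 1) / ((r : ℝ) - t) * ((commonNbrs G K).card : ℝ) + C ≤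
        (((commonNbrs G K).filter (G.Adj v)).card : ℝ) := by
  have hr0 : (0 : ℝ) < r := by exact_mod_cast (by omega : 0 < r)
  have hrt : (0 : ℝ) < (r : ℝ) - t := by
    have : (t : ℝ) + 1 ≤ r := by exact_mod_cast (by omega : t + 1 ≤ r)
    linarith
  have hnon : ∀ x, (((G.neighborFinset x)ᶜ.card : ℕ) : ℝ) ≤ (Fintype.card W : ℝ) / r - C := by
    intro x
    have h1 : (G.neighborFinset x)ᶜ.card + G.degree x = Fintype.card W := by
      rw [← G.card_neighborFinset_eq_degree x, add_comm]
      exact Finset.card_add_card_compl _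
    have h2 : ((G.neighborFinset x)ᶜ.card : ℝ) + G.degree x = Fintype.card W := by
      exact_mod_cast h1
    have h3 : (G.minDegree : ℝ) ≤ G.degree x := by
      exact_mod_cast G.minDegree_le_degree x
    have h4 : ((r : ℝ) - 1) / r * (Fintype.card W)
        = Fintype.card W - (Fintype.card W : ℝ) / r := by
      field_simp
    linarith
  have hN : (Fintype.card W : ℝ) ≤
      (commonNbrs G K).card + t * ((Fintype.card W : ℝ) / r - C) := by
    have hsub : (Finset.univ : Finset W) ⊆
        commonNbrs G K ∪ K.biUnion (fun x => (G.neighborFinset x)ᶜ) := by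
      intro w _
      by_cases h : ∀ x ∈ K, G.Adj x w
      · exact Finset.mem_union_left _ (by simpa [commonNbrs] using h)
      · push Not at h
        obtain ⟨x, hx, hxw⟩ := h
        refine Finset.mem_union_right _ (Finset.mem_biUnion.2 ⟨x, hx, ?_⟩)
        simpa using hxw
    have h1 : Fintype.card W ≤
        (commonNbrs G K).card + ∑ x ∈ K, (G.neighborFinset x)ᶜ.card :=
      (Finset.card_le_card hsub).trans ((Finset.card_union_le _ _).trans
        (Nat.add_le_add_left Finset.card_biUnion_le _))
    have h2 : (Fintype.card W : ℝ) ≤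
        (commonNbrs G K).card + ∑ x ∈ K, ((G.neighborFinset x)ᶜ.card : ℝ) := by
      exact_mod_cast h1
    have h3 := Finset.sum_le_sum (s := K) (fun x _ => hnon x)
    rw [Finset.sum_const, hK.card_eq, nsmul_eq_mul] at h3
    linarith
  intro v _
  have hv : ((commonNbrs G K).card : ℝ) ≤
      ((commonNbrs G K).filter (G.Adj v)).card + ((Fintype.card W : ℝ) / r - C) := by
    have h1 := Finset.card_filter_add_card_filter_not (s := commonNbrs G K) (G.Adj v)
    have h2 : ((commonNbrs G K).filter (fun w => ¬ G.Adj v w)).card ≤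
        (G.neighborFinset v)ᶜ.card := by
      apply Finset.card_le_card
      intro w hw
      simpa using (Finset.mem_filter.1 hw).2
    have h3 : ((commonNbrs G K).card : ℝ) ≤
        ((commonNbrs G K).filter (G.Adj v)).card + ((G.neighborFinset v)ᶜ.card : ℝ) := by
      exact_mod_cast (by omega)
    linarith [hnon v]
  have hq : (Fintype.card W : ℝ) / r ≤ ((commonNbrs G K).card : ℝ) / ((r : ℝ) - t) := by
    rw [le_div_iff₀ hrt]
    have h1 : (Fintype.card W : ℝ) / r * r = Fintype.card W := by field_simp
    have h2 : 0 ≤ (t : ℝ) * C := by positivity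
    nlinarith
  have he : ((r : ℝ) - t - 1) / ((r : ℝ) - t) * ((commonNbrs G K).card : ℝ)
      = (commonNbrs G K).card - ((commonNbrs G K).card : ℝ) / ((r : ℝ) - t) := by
    have := hrt.ne'
    field_simp
  linarith
end

section
/- Let r ≥ 3 and let (G,f) be a q-edge-colored graph with minimum degree δ(G) ≥ ((r−1)/r)·|V(G)| + 3 and no K_r-template. Let K be a copy of K_{r−2} in G, and let (v, x_1y_1, x_2y_2) be a bowtie all of whose five vertices lie in the common neighborhood N(K). Then the multiset {f(x_1y_1), f(vx_2), f(vy_2)} equals the multiset {f(x_2y_2), f(vx_1), f(vy_1)}. -/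
open Finset

/-- At most `r` vertices have a common neighbour outside any three given vertices. -/
lemma exists_common_neighbor (r : ℕ) (hr : 3 ≤ r)
    {W : Type} [Fintype W] [DecidableEq W]
    (G : SimpleGraph W) [DecidableRel G.Adj]
    (hδ : ((r : ℝ) - 1) / r * (Fintype.card W) + 3 ≤ G.minDegree)
    (S : Finset W) (hS : S.card ≤ r) (a b c : W) :
    ∃ u, u ≠ a ∧ u ≠ b ∧ u ≠ c ∧ ∀ z ∈ S, G.Adj z u := by
  by_contra hcon
  push Not at hcon
  have hsub : (Finset.univ : Finset W) ⊆
      ({a, b, c} : Finset W) ∪ S.biUnion (fun z => (G.neighborFinset z)ᶜ) := by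
    intro u _
    by_cases ha : u = a
    · simp [ha]
    by_cases hb : u = b
    · simp [hb]
    by_cases hc : u = c
    · simp [hc]
    obtain ⟨z, hz, hzu⟩ := hcon u ha hb hc
    refine Finset.mem_union_right _ (Finset.mem_biUnion.2 ⟨z, hz, ?_⟩)
    simpa using hzu
  have hcard := (Finset.card_le_card hsub).trans (Finset.card_union_le _ _)
  have h3 : ({a, b, c} : Finset W).card ≤ 3 := Finset.card_le_three
  have hB : (S.biUnion (fun z => (G.neighborFinset z)ᶜ)).card
      ≤ S.card * (Fintype.card W - G.minDegree) := by
    refine Finset.card_biUnion_le_card_mul _ _ _ (fun z _ => ?_)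
    rw [Finset.card_compl, SimpleGraph.card_neighborFinset_eq_degree]
    exact Nat.sub_le_sub_left (G.minDegree_le_degree z) _
  have hB2 := hB.trans (Nat.mul_le_mul_right (Fintype.card W - G.minDegree) hS)
  have hle : G.minDegree ≤ Fintype.card W :=
    (G.minDegree_le_degree a).trans (G.degree_lt_card_verts a).le
  rw [Finset.card_univ] at hcard
  have hN : Fintype.card W ≤ 3 + r * (Fintype.card W - G.minDegree) := by omega
  have hR : (Fintype.card W : ℝ) ≤ 3 + r * ((Fintype.card W : ℝ) - G.minDegree) := by
    rw [← Nat.cast_sub hle]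
    exact_mod_cast hN
  have hr' : (3 : ℝ) ≤ r := by exact_mod_cast hr
  have hm := mul_le_mul_of_nonneg_left hδ (by linarith : (0 : ℝ) ≤ r)
  have he : (r : ℝ) * (((r : ℝ) - 1) / r * (Fintype.card W) + 3)
      = (r - 1) * (Fintype.card W) + 3 * r := by
    field_simp
  rw [he] at hm
  nlinarith

/-- **Lemma (bowtie lemma).** Let `r ≥ 3` and let `(G, f)` be a `q`-edge-colored graph with
`δ(G) ≥ ((r−1)/r)|V(G)| + 3` and no `K_r`-template.  Let `K` be an `(r−2)`-clique and let
`(v, x₁y₁, x₂y₂)` be a bowtie contained in `N(K)`.  Then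
`{f(x₁y₁), f(vx₂), f(vy₂)} = {f(x₂y₂), f(vx₁), f(vy₁)}` as multisets. -/
theorem bowtie_lemma (r q : ℕ) (hr : 3 ≤ r)
    {W : Type} [Fintype W] [DecidableEq W]
    (G : SimpleGraph W) [DecidableRel G.Adj] (f : Sym2 W → Fin q)
    (hδ : ((r : ℝ) - 1) / r * (Fintype.card W) + 3 ≤ G.minDegree)
    (hTemp : ¬ HasKrTemplate G f r)
    (K : Finset W) (hK : G.IsNClique (r - 2) K)
    (v x₁ y₁ x₂ y₂ : W) (hdist : ([v, x₁, y₁, x₂, y₂] : List W).Nodup)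
    (h1 : G.Adj v x₁) (h2 : G.Adj v y₁) (h3 : G.Adj x₁ y₁)
    (h4 : G.Adj v x₂) (h5 : G.Adj v y₂) (h6 : G.Adj x₂ y₂)
    (hN : ∀ z ∈ K, G.Adj z v ∧ G.Adj z x₁ ∧ G.Adj z y₁ ∧ G.Adj z x₂ ∧ G.Adj z y₂) :
    ({f s(x₁, y₁), f s(v, x₂), f s(v, y₂)} : Multiset (Fin q)) =
      ({f s(x₂, y₂), f s(v, x₁), f s(v, y₁)} : Multiset (Fin q)) := by
  have hnd := hdist
  simp only [List.nodup_cons, List.mem_cons, List.not_mem_nil, or_false, not_or,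
    List.nodup_nil, not_false_eq_true, and_true] at hnd
  obtain ⟨⟨d1, d2, d3, d4⟩, ⟨d5, d6, d7⟩, ⟨d8, d9⟩, d10⟩ := hnd
  obtain ⟨u, hu1, hu2, hu3, hu⟩ := exists_common_neighbor r hr G hδ
    (insert y₁ (insert x₂ K)) (by
      have e1 := Finset.card_insert_le y₁ (insert x₂ K)
      have e2 := Finset.card_insert_le x₂ K
      have e3 := hK.card_eq
      omega) v x₁ y₂
  have hy : G.Adj y₁ u := hu _ (by simp)
  have hx : G.Adj x₂ u := hu _ (by simp)
  have hKu : ∀ z ∈ K, G.Adj z u := fun z hz => hu _ (by simp [hz])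
  have hu4 : u ≠ y₁ := hy.ne'
  have hu5 : u ≠ x₂ := hx.ne'
  have c4 : ({f s(v, y₁), f s(u, x₂)} : Multiset (Fin q)) = {f s(y₁, u), f s(x₂, v)} := by
    by_contra hne
    refine hTemp ⟨K, 2, fun i => [v, y₁, u, x₂].getD i v, hK, Or.inl rfl, ?_, ?_, ?_, ?_⟩
    · intro i hi j hj h
      interval_cases i <;> interval_cases j <;> simp_all
    · intro i hi z hz
      have := hN z hz
      have := hKu z hz
      interval_cases i <;> simp_all
    · intro i hi
      interval_cases i <;> simp [h2, hy, hx.symm, h4.symm]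
    · exact hne
  have c6 : ({f s(v, x₁), f s(y₁, u), f s(x₂, y₂)} : Multiset (Fin q))
      = {f s(x₁, y₁), f s(u, x₂), f s(y₂, v)} := by
    by_contra hne
    refine hTemp ⟨K, 3, fun i => [v, x₁, y₁, u, x₂, y₂].getD i v, hK, Or.inr rfl,
      ?_, ?_, ?_, ?_⟩
    · intro i hi j hj h
      have hn : [v, x₁, y₁, u, x₂, y₂].Nodup := by
        simp_all [eq_comm]
      beta_reduce at h
      rw [List.getD_eq_getElem _ _ (by simpa using hi),
        List.getD_eq_getElem _ _ (by simpa using hj)] at h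
      exact (hn.getElem_inj_iff).1 h
    · intro i hi z hz
      have := hN z hz
      have := hKu z hz
      interval_cases i <;> simp_all
    · intro i hi
      interval_cases i <;> simp [h1, h3, hy, hx.symm, h6, h5.symm]
    · exact hne
  rw [Sym2.eq_swap (a := x₂) (b := v)] at c4
  rw [Sym2.eq_swap (a := y₂) (b := v)] at c6
  simp only [Multiset.insert_eq_cons, ← Multiset.singleton_add] at c4 c6 ⊢
  have hs := congrArg₂ (· + ·) c4 c6
  apply add_right_cancel (b := ({f s(u, x₂)} + {f s(y₁, u)} : Multiset (Fin q)))
  calc _ = _ := by abel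
    _ = _ := hs.symm
    _ = _ := by abel
end

section
/- Let r ≥ 3 and let G be a graph with minimum degree δ(G) ≥ ((r−1)/r)·|V(G)| + 2. Let v ∈ V(G), let K ⊆ N(v) be an r-clique contained in the neighborhood of v, let x ∈ K, and let uw ∈ E(G) be an edge with u, w ∈ N(v). Then there exists a sequence of r-cliques K_1, …, K_m ⊆ N(v) such that K_1 = K, u, w ∈ K_m, x ∈ K_i for every 1 ≤ i ≤ m−2, and |K_i ∩ K_{i+1}| = r−2 for every 1 ≤ i ≤ m−1. -/
open Finset

namespace ChainAux

/-- Every set `S` of at most `r` vertices has a common neighbour outside a small set `T`. -/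
def Ext {W : Type} [DecidableEq W] (G : SimpleGraph W) (r : ℕ) : Prop :=
  ∀ S T : Finset W, S.card ≤ r → T.card < 2 * r → ∃ y, y ∉ T ∧ ∀ s ∈ S, G.Adj s y

theorem ext_of_minDegree (r : ℕ) (hr : 3 ≤ r)
    {W : Type} [Fintype W] [DecidableEq W]
    (G : SimpleGraph W) [DecidableRel G.Adj]
    (hδ : ((r : ℝ) - 1) / r * (Fintype.card W) + 2 ≤ G.minDegree) : Ext G r := by
  intro S T hS hT
  by_contra! hcon
  have hr0 : (0 : ℝ) < r := by positivity
  have h1 : ((r : ℝ) - 1) * (Fintype.card W) + 2 * r ≤ r * G.minDegree := by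
    have := mul_le_mul_of_nonneg_left hδ hr0.le
    have e : (r : ℝ) * (((r : ℝ) - 1) / r * (Fintype.card W) + 2)
        = ((r : ℝ) - 1) * (Fintype.card W) + 2 * r := by
      field_simp
    linarith
  have hcov : (Finset.univ : Finset W) ⊆ T ∪ S.biUnion (fun s => (G.neighborFinset s)ᶜ) := by
    intro y _
    by_cases hy : y ∈ T
    · simp [hy]
    · obtain ⟨s, hs, hsy⟩ := hcon y hy
      simp only [mem_union, mem_biUnion]
      exact Or.inr ⟨s, hs, by simpa using hsy⟩
  have h2 := Finset.card_le_card hcov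
  have h3 := (Finset.card_union_le T (S.biUnion (fun s => (G.neighborFinset s)ᶜ)))
  have h4 : (S.biUnion (fun s => (G.neighborFinset s)ᶜ)).card
      ≤ S.card * (Fintype.card W - G.minDegree) := by
    apply Finset.card_biUnion_le_card_mul
    intro s _
    rw [Finset.card_compl, SimpleGraph.card_neighborFinset_eq_degree]
    have := G.minDegree_le_degree s
    omega
  have h5 : S.card * (Fintype.card W - G.minDegree) ≤ r * (Fintype.card W - G.minDegree) :=
    Nat.mul_le_mul_right _ hS
  rw [Finset.card_univ] at h2
  have h6 : Fintype.card W < 2 * r + r * (Fintype.card W - G.minDegree) := by omega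
  by_cases hle : G.minDegree ≤ Fintype.card W
  · have h7 : (Fintype.card W : ℝ) < 2 * r + r * ((Fintype.card W : ℝ) - G.minDegree) := by
      rw [← Nat.cast_sub hle]
      exact_mod_cast h6
    nlinarith
  · rcases isEmpty_or_nonempty W with hW | ⟨⟨a⟩⟩
    · have : G.minDegree = 0 := by simp
      omega
    · have := G.minDegree_le_degree a
      have := G.degree_lt_card_verts a
      omega

theorem exists_clique {W : Type} [DecidableEq W] {G : SimpleGraph W} {r : ℕ} (hE : Ext G r)
    (hr : 3 ≤ r) : ∀ (j : ℕ) (S : Finset W), S.card + j ≤ r + 1 →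
      ∃ A : Finset W, G.IsNClique j A ∧ ∀ s ∈ S, ∀ a ∈ A, G.Adj s a := by
  intro j
  induction j with
  | zero => intro S _; exact ⟨∅, by simp [SimpleGraph.isNClique_iff], by simp⟩
  | succ j ih =>
    intro S hS
    obtain ⟨y, -, hy⟩ := hE S ∅ (by omega) (by simp; omega)
    obtain ⟨A, hA, hSA⟩ := ih (insert y S) (by
      have := Finset.card_insert_le y S
      omega)
    refine ⟨insert y A, hA.insert (fun b hb => hSA y (by simp) b hb), ?_⟩
    intro s hs a ha
    rcases Finset.mem_insert.1 ha with rfl | ha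
    · exact hy s hs
    · exact hSA s (by simp [hs]) a ha

/-- An `r`-clique in the neighbourhood of `v`. -/
def Good {W : Type} (G : SimpleGraph W) (r : ℕ) (v : W) (K : Finset W) : Prop :=
  G.IsNClique r K ∧ ∀ y ∈ K, G.Adj v y

theorem exists_good {W : Type} [DecidableEq W] {G : SimpleGraph W} {r : ℕ} (hE : Ext G r)
    (hr : 3 ≤ r) (v : W) (f : ℕ) (F : Finset W) (hf : f ≤ r) (hF : Good G f v F) :
    ∃ K, F ⊆ K ∧ Good G r v K := by
  obtain ⟨A, hA, hSA⟩ := exists_clique hE hr (r - f) (insert v F) (by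
    have := Finset.card_insert_le v F
    have := hF.1.card_eq
    omega)
  have hd : Disjoint F A := by
    rw [Finset.disjoint_left]
    intro a ha ha'
    exact (hSA a (by simp [ha]) a ha').ne rfl
  refine ⟨F ∪ A, Finset.subset_union_left, ⟨?_, ?_⟩, ?_⟩
  · intro a ha b hb hab
    simp only [coe_union, Set.mem_union, mem_coe] at ha hb
    rcases ha with ha | ha <;> rcases hb with hb | hb
    · exact hF.1.1 ha hb hab
    · exact hSA a (by simp [ha]) b hb
    · exact (hSA b (by simp [hb]) a ha).symm
    · exact hA.1 ha hb hab
  · rw [Finset.card_union_of_disjoint hd, hF.1.card_eq, hA.card_eq]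
    omega
  · intro y hy
    rcases Finset.mem_union.1 hy with hy | hy
    · exact hF.2 y hy
    · exact hSA v (by simp) y hy

/-- One step of the chain, keeping `x`. -/
def Step {W : Type} [DecidableEq W] (G : SimpleGraph W) (r : ℕ) (v x : W)
    (K L : Finset W) : Prop :=
  (Good G r v K ∧ x ∈ K) ∧ (Good G r v L ∧ x ∈ L) ∧ (K ∩ L).card = r - 2

theorem Good.insert {W : Type} [DecidableEq W] {G : SimpleGraph W} {f : ℕ} {v a : W}
    {F : Finset W} (hF : Good G f v F) (ha : ∀ s ∈ F, G.Adj s a) (hv : G.Adj v a) :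
    Good G (f + 1) v (insert a F) :=
  ⟨hF.1.insert (fun b hb => (ha b hb).symm), by
    intro y hy
    rcases Finset.mem_insert.1 hy with rfl | hy
    · exact hv
    · exact hF.2 y hy⟩

theorem Good.sub {W : Type} {G : SimpleGraph W} {r : ℕ} {v : W}
    {F K : Finset W} (hK : Good G r v K) (h : F ⊆ K) : Good G F.card v F :=
  ⟨⟨hK.1.1.subset (by exact_mod_cast h), rfl⟩, fun y hy => hK.2 y (h hy)⟩

theorem connected {W : Type} [DecidableEq W] {G : SimpleGraph W} {r : ℕ} (hE : Ext G r)
    (hr : 3 ≤ r) (v x : W) : ∀ (j : ℕ) (F K L : Finset W), F.card + 2 + j = r → x ∈ F →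
      F ⊆ K → F ⊆ L → Good G r v K → Good G r v L →
      Relation.ReflTransGen (Step G r v x) K L := by
  intro j
  induction j with
  | zero =>
    intro F K L hc hx hFK hFL hK hL
    have hU : (K ∪ L).card < 2 * r := by
      have h1 := Finset.card_union_add_card_inter K L
      have h2 := Finset.card_le_card (Finset.subset_inter hFK hFL)
      have := hK.1.card_eq
      have := hL.1.card_eq
      omega
    have hF := hK.sub hFK
    obtain ⟨c, hcT, hcA⟩ := hE (insert v F) (K ∪ L) (by
      have := Finset.card_insert_le v F
      omega) hU
    obtain ⟨d, hdT, hdA⟩ := hE (insert c (insert v F)) (K ∪ L) (by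
      have := Finset.card_insert_le v F
      have := Finset.card_insert_le c (insert v F)
      omega) hU
    have h1 := hF.insert (a := c) (fun s hs => hcA s (by simp [hs])) (hcA v (by simp))
    have h2 := h1.insert (a := d) (fun s hs => hdA s (by
      rcases Finset.mem_insert.1 hs with rfl | hs <;> simp [*])) (hdA v (by simp))
    have e : F.card + 1 + 1 = r := by omega
    rw [e] at h2
    have key : ∀ M : Finset W, F ⊆ M → M ⊆ K ∪ L → (M ∩ insert d (insert c F)).card = r - 2 := by
      intro M hFM hM
      have : M ∩ insert d (insert c F) = F := by
        ext y
        simp only [mem_inter, mem_insert]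
        constructor
        · rintro ⟨hy, rfl | rfl | h⟩
          · exact absurd (hM hy) hdT
          · exact absurd (hM hy) hcT
          · exact h
        · intro h
          exact ⟨hFM h, Or.inr (Or.inr h)⟩
      rw [this]
      omega
    refine (Relation.ReflTransGen.single (b := insert d (insert c F)) ?_).tail ?_
    · exact ⟨⟨hK, hFK hx⟩, ⟨h2, by simp [hx]⟩, key K hFK Finset.subset_union_left⟩
    · refine ⟨⟨h2, by simp [hx]⟩, ⟨hL, hFL hx⟩, ?_⟩
      rw [Finset.inter_comm]
      exact key L hFL Finset.subset_union_right
  | succ j ih =>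
    intro F K L hc hx hFK hFL hK hL
    have ex : ∀ M : Finset W, F ⊆ M → Good G r v M → ∃ a ∈ M, a ∉ F := by
      intro M hFM hM
      by_contra! h
      have := Finset.card_le_card (show M ⊆ F from h)
      have := hM.1.card_eq
      omega
    obtain ⟨a, haK, haF⟩ := ex K hFK hK
    obtain ⟨d, hdL, hdF⟩ := ex L hFL hL
    obtain ⟨g, -, hg⟩ := hE (insert a (insert d (insert v F))) ∅ (by
      have := Finset.card_insert_le v F
      have := Finset.card_insert_le d (insert v F)
      have := Finset.card_insert_le a (insert d (insert v F))
      omega) (by simp; omega)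
    have hgF : g ∉ F := fun h => (hg g (by simp [h])).ne rfl
    have mk : ∀ b, b ∉ F → G.Adj b g → Good G (insert b F).card v (insert b F) →
        ∃ M, insert g (insert b F) ⊆ M ∧ Good G r v M := by
      intro b hb hbg hG
      refine exists_good hE hr v _ _ ?_ (hG.insert (a := g) ?_ (hg v (by simp)))
      · rw [Finset.card_insert_of_notMem hb]; omega
      · intro s hs
        rcases Finset.mem_insert.1 hs with rfl | hs
        · exact hbg
        · exact hg s (by simp [hs])
    have hsK : insert a F ⊆ K := Finset.insert_subset haK hFK
    have hsL : insert d F ⊆ L := Finset.insert_subset hdL hFL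
    obtain ⟨M, hM, hMG⟩ := mk a haF (hg a (by simp)) (hK.sub hsK)
    obtain ⟨N, hN, hNG⟩ := mk d hdF (hg d (by simp)) (hL.sub hsL)
    have card : ∀ b, b ∉ F → (insert b F).card + 2 + j = r := by
      intro b hb
      rw [Finset.card_insert_of_notMem hb]; omega
    have s1 := ih (insert a F) K M (card a haF) (by simp [hx]) hsK
      ((Finset.subset_insert _ _).trans hM) hK hMG
    have s2 := ih (insert g F) M N (card g hgF) (by simp [hx])
      ((Finset.insert_subset_insert _ (Finset.subset_insert _ _)).trans hM)
      ((Finset.insert_subset_insert _ (Finset.subset_insert _ _)).trans hN) hMG hNG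
    have s3 := ih (insert d F) N L (card d hdF) (by simp [hx])
      ((Finset.subset_insert _ _).trans hN) hsL hNG hL
    exact (s1.trans s2).trans s3

/-- The conclusion of the chain lemma, for the starting clique `K`. -/
def Concl {W : Type} [DecidableEq W] (G : SimpleGraph W) (r : ℕ) (v x u w : W)
    (K : Finset W) : Prop :=
  ∃ (m : ℕ) (Ks : ℕ → Finset W), 0 < m ∧ Ks 0 = K ∧
      (∀ i < m, G.IsNClique r (Ks i) ∧ ∀ y ∈ Ks i, G.Adj v y) ∧
      u ∈ Ks (m - 1) ∧ w ∈ Ks (m - 1) ∧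
      (∀ i < m - 2, x ∈ Ks i) ∧
      (∀ i, i + 1 < m → (Ks i ∩ Ks (i + 1)).card = r - 2)

theorem Concl.cons {W : Type} [DecidableEq W] {G : SimpleGraph W} {r : ℕ} {v x u w : W}
    {K L : Finset W} (hK : Good G r v K) (hI : (K ∩ L).card = r - 2)
    (h : Concl G r v x u w L) (hx : x ∈ K) : Concl G r v x u w K := by
  obtain ⟨m, Ks, hm, h0, hG, hu, hw, hxs, hc⟩ := h
  obtain ⟨m, rfl⟩ : ∃ k, m = k + 1 := ⟨m - 1, by omega⟩
  refine ⟨m + 2, fun i => Nat.casesOn i K Ks, by omega, rfl, ?_, by exact hu, by exact hw, ?_, ?_⟩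
  · rintro (_ | i) hi
    · exact hK
    · exact hG i (by omega)
  · rintro (_ | i) hi
    · exact hx
    · exact hxs i (by omega)
  · rintro (_ | i) hi
    · simpa [h0] using hI
    · exact hc i (by omega)

theorem concl_two {W : Type} [DecidableEq W] {G : SimpleGraph W} {r : ℕ} {v x u w : W}
    {K L : Finset W} (hK : Good G r v K) (hL : Good G r v L) (hI : (K ∩ L).card = r - 2)
    (hu : u ∈ L) (hw : w ∈ L) : Concl G r v x u w K := by
  refine ⟨2, fun i => Nat.casesOn i K (fun _ => L), by omega, rfl, ?_, hu, hw, ?_, ?_⟩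
  · rintro (_ | i) hi
    · exact hK
    · exact hL
  · intro i hi
    omega
  · rintro (_ | i) hi
    · exact hI
    · omega

theorem good_triple {W : Type} [DecidableEq W] {G : SimpleGraph W} {r : ℕ} (hr : 3 ≤ r) {v : W}
    {A : Finset W} (hA : Good G (r - 3) v A) {a b c : W}
    (ha : ∀ s ∈ A, G.Adj s a) (hb : ∀ s ∈ A, G.Adj s b) (hc : ∀ s ∈ A, G.Adj s c)
    (hab : G.Adj a b) (hac : G.Adj a c) (hbc : G.Adj b c)
    (hva : G.Adj v a) (hvb : G.Adj v b) (hvc : G.Adj v c) :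
    Good G r v (insert c (insert b (insert a A))) := by
  have h := ((hA.insert ha hva).insert (a := b) (by
    intro s hs
    rcases Finset.mem_insert.1 hs with rfl | hs
    · exact hab
    · exact hb s hs) hvb).insert (a := c) (by
    intro s hs
    simp only [mem_insert] at hs
    rcases hs with rfl | rfl | hs
    · exact hbc
    · exact hac
    · exact hc s hs) hvc
  have e : r - 3 + 1 + 1 + 1 = r := by omega
  rwa [e] at h

theorem inter_triple {W : Type} [DecidableEq W] {r : ℕ} (hr : 3 ≤ r)
    {A : Finset W} (hA : A.card = r - 3) {a b c d e : W} (ha : a ∉ A)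
    (hb : b ∉ A) (hc : c ∉ A)
    (hba : b ≠ a) (hca : c ≠ a) (hbd : b ≠ d) (hbe : b ≠ e) (hcd : c ≠ d) (hce : c ≠ e) :
    ∀ K L : Finset W, (∀ y, y ∈ K ↔ y = a ∨ y = b ∨ y = c ∨ y ∈ A) →
      (∀ y, y ∈ L ↔ y = a ∨ y = d ∨ y = e ∨ y ∈ A) → (K ∩ L).card = r - 2 := by
  intro K L hK hL
  have : K ∩ L = insert a A := by
    ext y
    simp only [mem_inter, hK, hL, mem_insert]
    constructor
    · rintro ⟨rfl | rfl | rfl | h1, h2⟩ <;> simp_all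
    · rintro (h | h) <;> simp [h]
  rw [this, Finset.card_insert_of_notMem ha]
  omega

theorem exists_end {W : Type} [DecidableEq W] {G : SimpleGraph W} {r : ℕ} (hE : Ext G r)
    (hr : 3 ≤ r) {v x u w : W} (hvx : G.Adj v x)
    (huw : G.Adj u w) (hu : G.Adj v u) (hw : G.Adj v w) :
    ∃ K, x ∈ K ∧ Good G r v K ∧ Concl G r v x u w K := by
  have c3 : ∀ a b c : W, ∀ A : Finset W, A.card = r - 3 →
      (insert a (insert b (insert c A))).card ≤ r := by
    intro a b c A hA
    have := Finset.card_insert_le c A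
    have := Finset.card_insert_le b (insert c A)
    have := Finset.card_insert_le a (insert b (insert c A))
    omega
  have c2 : ∀ a b c : W, ({a, b, c} : Finset W).card < 2 * r := by
    intro a b c
    have := Finset.card_le_three (a := a) (b := b) (c := c)
    omega
  obtain ⟨A, hA, hSA⟩ := exists_clique hE hr (r - 3) {v, u, w, x} (by
    have := Finset.card_le_four (a := v) (b := u) (c := w) (d := x)
    omega)
  have hAc := hA.card_eq
  have hAv : Good G (r - 3) v A := ⟨hA, fun y hy => hSA v (by simp) y hy⟩
  have hAu : ∀ s ∈ A, G.Adj s u := fun s hs => (hSA u (by simp) s hs).symm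
  have hAw : ∀ s ∈ A, G.Adj s w := fun s hs => (hSA w (by simp) s hs).symm
  have hAx : ∀ s ∈ A, G.Adj s x := fun s hs => (hSA x (by simp) s hs).symm
  have nm : ∀ y, (∀ s ∈ A, G.Adj s y) → y ∉ A := fun y h hy => (h y hy).ne rfl
  obtain ⟨p, hp, hpS⟩ := hE (insert v (insert u (insert x A))) {w, w, w} (c3 _ _ _ _ hAc) (c2 _ _ _)
  have hAp : ∀ s ∈ A, G.Adj s p := fun s hs => hpS s (by simp [hs])
  have hvp := hpS v (by simp)
  have hup := hpS u (by simp)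
  have hxp := hpS x (by simp)
  obtain ⟨q', hq', hqS'⟩ := hE (insert v (insert p (insert x A))) {u, w, w}
    (c3 _ _ _ _ hAc) (c2 _ _ _)
  have hAq' : ∀ s ∈ A, G.Adj s q' := fun s hs => hqS' s (by simp [hs])
  have hvq' := hqS' v (by simp)
  have hpq' := hqS' p (by simp)
  have hxq' := hqS' x (by simp)
  obtain ⟨q, hq, hqS⟩ := hE (insert v (insert p (insert u A))) {q', w, x}
    (c3 _ _ _ _ hAc) (c2 _ _ _)
  have hAq : ∀ s ∈ A, G.Adj s q := fun s hs => hqS s (by simp [hs])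
  have hvq := hqS v (by simp)
  have hpq := hqS p (by simp)
  have huq := hqS u (by simp)
  obtain ⟨z, hz, hzS⟩ := hE (insert v (insert w (insert u A))) {p, q, q'}
    (c3 _ _ _ _ hAc) (c2 _ _ _)
  have hAz : ∀ s ∈ A, G.Adj s z := fun s hs => hzS s (by simp [hs])
  have hvz := hzS v (by simp)
  have hwz := hzS w (by simp)
  have huz := hzS u (by simp)
  simp only [mem_insert, mem_singleton, not_or] at hp hq hq' hz
  obtain ⟨hpw, -, -⟩ := hp
  obtain ⟨hqu', hqw', -⟩ := hq'
  obtain ⟨hqq, hqw, hqx⟩ := hq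
  obtain ⟨hzp, hzq, hzq'⟩ := hz
  have G1 := good_triple hr hAv hAx hAp hAq' hxp hxq' hpq' hvx hvp hvq'
  have G2 := good_triple hr hAv hAp hAu hAq hup.symm hpq huq hvp hu hvq
  have G3 := good_triple hr hAv hAu hAw hAz huw huz hwz hu hw hvz
  refine ⟨_, ?_, G1, ?_⟩
  · simp
  by_cases hxu : x = u
  · subst hxu
    refine concl_two G1 G3 ?_ (by simp) (by simp)
    refine inter_triple (a := x) (b := p) (c := q') (d := w) (e := z) hr hAc (nm _ hAx) (nm _ hAp)
      (nm _ hAq') hxp.ne' hxq'.ne' hpw (Ne.symm hzp) hqw' (Ne.symm hzq') _ _ ?_ ?_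
    · intro y; simp only [mem_insert]; tauto
    · intro y; simp only [mem_insert]; tauto
  · refine Concl.cons G1 ?_ (concl_two G2 G3 ?_ (by simp) (by simp)) (by simp)
    · refine inter_triple (a := p) (b := x) (c := q') (d := u) (e := q) hr hAc (nm _ hAp)
        (nm _ hAx) (nm _ hAq') hxp.ne hpq'.ne' hxu (Ne.symm hqx) hqu' (Ne.symm hqq) _ _ ?_ ?_
      · intro y; simp only [mem_insert]; tauto
      · intro y; simp only [mem_insert]; tauto
    · refine inter_triple (a := u) (b := p) (c := q) (d := w) (e := z) hr hAc (nm _ hAu)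
        (nm _ hAp) (nm _ hAq) hup.ne' huq.ne' hpw (Ne.symm hzp) hqw (Ne.symm hzq) _ _ ?_ ?_
      · intro y; simp only [mem_insert]; tauto
      · intro y; simp only [mem_insert]; tauto

end ChainAux

/-- **Lemma (chain lemma).** Let `r ≥ 3` and let `G` satisfy
`δ(G) ≥ ((r−1)/r)|V(G)| + 2`.  Let `v` be a vertex, `K ⊆ N(v)` an `r`-clique, `x ∈ K`, and
let `uw` be an edge with `u, w ∈ N(v)`.  Then there is a sequence of `r`-cliques
`K_1, …, K_m ⊆ N(v)` (here `Ks 0, …, Ks (m−1)`) with `K_1 = K`, `u, w ∈ K_m`,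
`x ∈ K_1, …, K_{m−2}`, and `|K_i ∩ K_{i+1}| = r − 2` for all `i`. -/
theorem chain_lemma (r : ℕ) (hr : 3 ≤ r)
    {W : Type} [Fintype W] [DecidableEq W]
    (G : SimpleGraph W) [DecidableRel G.Adj]
    (hδ : ((r : ℝ) - 1) / r * (Fintype.card W) + 2 ≤ G.minDegree)
    (v : W) (K : Finset W) (hKv : ∀ y ∈ K, G.Adj v y) (hK : G.IsNClique r K)
    (x : W) (hx : x ∈ K)
    (u w : W) (huw : G.Adj u w) (hu : G.Adj v u) (hw : G.Adj v w) :
    ∃ (m : ℕ) (Ks : ℕ → Finset W), 0 < m ∧ Ks 0 = K ∧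
      (∀ i < m, G.IsNClique r (Ks i) ∧ ∀ y ∈ Ks i, G.Adj v y) ∧
      u ∈ Ks (m - 1) ∧ w ∈ Ks (m - 1) ∧
      (∀ i < m - 2, x ∈ Ks i) ∧
      (∀ i, i + 1 < m → (Ks i ∩ Ks (i + 1)).card = r - 2) := by
  have hE := ChainAux.ext_of_minDegree r hr G hδ
  obtain ⟨L, hxL, hL, hC⟩ := ChainAux.exists_end hE hr (hKv x hx) huw hu hw
  have hR := ChainAux.connected hE hr v x (r - 3) {x} K L (by simp; omega) (by simp)
    (by simpa using hx) (by simpa using hxL) ⟨hK, hKv⟩ hL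
  change ChainAux.Concl G r v x u w K
  induction hR using Relation.ReflTransGen.head_induction_on with
  | refl => exact hC
  | head h _ ih =>
    exact ChainAux.Concl.cons h.1.1 h.2.2 (ih h.2.1.1.2 h.2.1.1.1 h.2.1.2) h.1.2
end

section
/- Let r ≥ 3 and let (G,f) be a q-edge-colored graph with no K_r-template, and let K be a copy of the complete graph K_{r+2} in G. Then K is either monochromatic (all edges of K have the same color) or a 2-colored-star: there exist a vertex v ∈ V(K) and two distinct colors c, c' such that every edge of K incident to v has color c and every edge of K not incident to v has color c'. -/
open Finset

/-- In an `(r+2)`-clique without template, every 4-cycle is balanced. -/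
theorem quad_balanced (r q : ℕ) (hr : 3 ≤ r) {W : Type} [DecidableEq W]
    (G : SimpleGraph W) (f : Sym2 W → Fin q) (hTemp : ¬ HasKrTemplate G f r)
    (K : Finset W) (hK : G.IsNClique (r + 2) K) (a b c d : W)
    (ha : a ∈ K) (hb : b ∈ K) (hc : c ∈ K) (hd : d ∈ K)
    (hab : a ≠ b) (hac : a ≠ c) (had : a ≠ d) (hbc : b ≠ c) (hbd : b ≠ d) (hcd : c ≠ d) :
    (f s(a, b) = f s(b, c) ∧ f s(c, d) = f s(d, a)) ∨
      (f s(a, b) = f s(d, a) ∧ f s(c, d) = f s(b, c)) := by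
  by_contra hne
  apply hTemp
  have hadj : ∀ x ∈ K, ∀ y ∈ K, x ≠ y → G.Adj x y := fun x hx y hy hxy =>
    hK.isClique (by simpa using hx) (by simpa using hy) hxy
  have hsub : ({a, b, c, d} : Finset W) ⊆ K := by
    intro x hx
    simp only [Finset.mem_insert, Finset.mem_singleton] at hx
    rcases hx with rfl | rfl | rfl | rfl <;> assumption
  have hcard : ({a, b, c, d} : Finset W).card = 4 := by
    rw [Finset.card_eq_of_equiv_fin]
    exact Finset.equivFinOfCardEq (by simp [*])
  let w : ℕ → W := fun i => if i = 0 then a else if i = 1 then b else if i = 2 then c else d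
  have hw0 : w 0 = a := rfl
  have hw1 : w 1 = b := rfl
  have hw2 : w 2 = c := rfl
  have hw3 : w 3 = d := rfl
  refine ⟨K \ {a, b, c, d}, 2, w, ⟨?_, ?_⟩, Or.inl rfl, ?_, ?_, ?_, ?_⟩
  · exact hK.isClique.subset (by simp)
  · rw [Finset.card_sdiff_of_subset hsub, hcard, hK.card_eq]
    omega
  · intro i hi j hj hij
    have hi' : i < 4 := hi
    have hj' : j < 4 := hj
    interval_cases i <;> interval_cases j <;> simp_all
  · intro i hi x hx
    have hi' : i < 4 := hi
    simp only [Finset.mem_sdiff, Finset.mem_insert, Finset.mem_singleton, not_or] at hx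
    obtain ⟨hxK, h1, h2, h3, h4⟩ := hx
    interval_cases i
    · exact hadj _ hxK _ ha h1
    · exact hadj _ hxK _ hb h2
    · exact hadj _ hxK _ hc h3
    · exact hadj _ hxK _ hd h4
  · intro i hi
    have hi' : i < 4 := hi
    interval_cases i
    · exact hadj _ ha _ hb hab
    · exact hadj _ hb _ hc hbc
    · exact hadj _ hc _ hd hcd
    · exact hadj _ hd _ ha had.symm
  · intro h
    apply hne
    have h' : (([f s(a, b), f s(c, d)] : List (Fin q)) : Multiset (Fin q)) =
        (([f s(b, c), f s(d, a)] : List (Fin q)) : Multiset (Fin q)) := h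
    rw [Multiset.coe_eq_coe] at h'
    have m1 := h'.mem_iff (a := f s(a, b))
    have c1 := fun x => h'.count_eq x
    simp only [List.count_cons, List.count_nil, beq_iff_eq] at c1
    simp only [List.mem_cons, List.not_mem_nil, or_false, true_or, true_iff] at m1
    have c2 := c1 (f s(c, d))
    have c3 := c1 (f s(a, b))
    grind

/-- Extending a star from a four-clique to the whole clique. -/
theorem star_of_quad {q : ℕ} {W : Type} [DecidableEq W] (K : Finset W) (g : W → W → Fin q)
    (hs : ∀ a b, g a b = g b a)
    (Q : ∀ a ∈ K, ∀ b ∈ K, ∀ c ∈ K, ∀ d ∈ K, a ≠ b → a ≠ c → a ≠ d → b ≠ c → b ≠ d → c ≠ d →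
      (g a b = g b c ∧ g c d = g d a) ∨ (g a b = g d a ∧ g c d = g b c))
    (v a b d : W) (hv : v ∈ K) (ha : a ∈ K) (hb : b ∈ K) (hd : d ∈ K)
    (hva : v ≠ a) (hvb : v ≠ b) (hvd : v ≠ d) (hab : a ≠ b) (had : a ≠ d) (hbd : b ≠ d)
    (c c' : Fin q) (hc : c ≠ c') (h1 : g v a = c) (h2 : g v b = c) (h3 : g v d = c)
    (h4 : g a b = c') (h5 : g a d = c') (h6 : g b d = c') :
    (∀ u ∈ K, u ≠ v → g v u = c) ∧
      (∀ u ∈ K, ∀ u' ∈ K, u ≠ v → u' ≠ v → u ≠ u' → g u u' = c') := by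
  have key : ∀ e ∈ K, e ≠ v → g v e = c ∧ (e ≠ a → g a e = c') := by
    intro e he hev
    by_cases hea : e = a
    · subst hea; exact ⟨h1, fun h => absurd rfl h⟩
    by_cases heb : e = b
    · subst heb; exact ⟨h2, fun _ => h4⟩
    by_cases hed : e = d
    · subst hed; exact ⟨h3, fun _ => h5⟩
    have q1 := Q v hv a ha b hb e he hva hvb hev.symm hab (Ne.symm hea) (Ne.symm heb)
    have q2 := Q v hv a ha e he b hb hva hev.symm hvb (Ne.symm hea) hab heb
    have q3 := Q a ha b hb d hd e he hab had (Ne.symm hea) hbd (Ne.symm heb) (Ne.symm hed)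
    have q4 := Q a ha b hb e he d hd hab (Ne.symm hea) had (Ne.symm heb) hbd hed
    have s1 := hs a e
    have s2 := hs b e
    have s3 := hs d e
    have s4 := hs v e
    have s5 := hs v b
    have s6 := hs a d
    have s7 := hs v a
    have s8 := hs v d
    clear Q hs
    grind
  refine ⟨fun u hu huv => (key u hu huv).1, ?_⟩
  intro u hu u' hu' huv hu'v huu'
  by_cases hua : u = a
  · subst hua; exact (key u' hu' hu'v).2 huu'.symm
  by_cases hu'a : u' = a
  · subst hu'a; rw [hs]; exact (key u hu huv).2 huu'
  have q1 := Q v hv a ha u hu u' hu' hva huv.symm hu'v.symm (Ne.symm hua) (Ne.symm hu'a) huu'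
  have k1 := key u hu huv
  have k2 := key u' hu' hu'v
  have s1 := hs v u'
  clear Q key
  grind

/-- **Lemma.** Let `r ≥ 3` and let `(G, f)` be a `q`-edge-colored graph with no
`K_r`-template.  Then every `(r+2)`-clique `K` of `G` is monochromatic or a 2-colored star:
there are a vertex `v ∈ K` and distinct colors `c ≠ c'` such that all edges of `K` at `v`
have color `c` and all edges of `K` avoiding `v` have color `c'`. -/
theorem Krplus2_mono_or_star (r q : ℕ) (hr : 3 ≤ r)
    {W : Type} [DecidableEq W]
    (G : SimpleGraph W) (f : Sym2 W → Fin q)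
    (hTemp : ¬ HasKrTemplate G f r)
    (K : Finset W) (hK : G.IsNClique (r + 2) K) :
    (∀ u ∈ K, ∀ v ∈ K, ∀ u' ∈ K, ∀ v' ∈ K, u ≠ v → u' ≠ v' →
      f s(u, v) = f s(u', v')) ∨
    (∃ v ∈ K, ∃ c c' : Fin q, c ≠ c' ∧
      (∀ u ∈ K, u ≠ v → f s(v, u) = c) ∧
      (∀ u ∈ K, ∀ u' ∈ K, u ≠ v → u' ≠ v → u ≠ u' → f s(u, u') = c')) := by
  classical
  have hs : ∀ a b : W, f s(a, b) = f s(b, a) := fun a b => by rw [Sym2.eq_swap]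
  have Q : ∀ a ∈ K, ∀ b ∈ K, ∀ c ∈ K, ∀ d ∈ K,
      a ≠ b → a ≠ c → a ≠ d → b ≠ c → b ≠ d → c ≠ d →
      (f s(a, b) = f s(b, c) ∧ f s(c, d) = f s(d, a)) ∨
        (f s(a, b) = f s(d, a) ∧ f s(c, d) = f s(b, c)) :=
    fun a ha b hb c hc d hd =>
      quad_balanced r q hr G f hTemp K hK a b c d ha hb hc hd
  by_cases hall : ∀ u ∈ K, ∀ v ∈ K, ∀ w ∈ K, u ≠ v → v ≠ w → f s(u, v) = f s(v, w)
  · left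
    intro u hu v hv u' hu' v' hv' huv hu'v'
    by_cases h : v = u'
    · subst h; exact hall u hu v hv v' hv' huv hu'v'
    · rw [hall u hu v hv u' hu' huv h, hall v hv u' hu' v' hv' h hu'v']
  · right
    push Not at hall
    obtain ⟨u, hu, v, hv, w, hw, huv, hvw, hne⟩ := hall
    have huw : u ≠ w := by
      rintro rfl
      exact hne (hs u v)
    obtain ⟨d, hd, hd'⟩ : ∃ d ∈ K, d ∉ ({u, v, w} : Finset W) := by
      apply Finset.exists_mem_notMem_of_card_lt_card
      have := Finset.card_le_three (a := u) (b := v) (c := w)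
      have := hK.card_eq
      omega
    simp only [Finset.mem_insert, Finset.mem_singleton, not_or] at hd'
    obtain ⟨hdu, hdv, hdw⟩ := hd'
    have q1 := Q u hu v hv w hw d hd huv huw (Ne.symm hdu) hvw (Ne.symm hdv) (Ne.symm hdw)
    have q2 := Q u hu v hv d hd w hw huv (Ne.symm hdu) huw (Ne.symm hdv) hvw hdw
    have s1 := hs u v
    have s2 := hs u w
    have s3 := hs u d
    have s4 := hs v w
    have s5 := hs v d
    have s6 := hs w d
    by_cases hx : f s(v, d) = f s(u, v)
    · refine ⟨w, hw, f s(v, w), f s(u, v), Ne.symm hne, ?_⟩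
      refine star_of_quad K (fun a b => f s(a, b)) hs Q w u v d hw hu hv hd
        (Ne.symm huw) (Ne.symm hvw) (Ne.symm hdw) huv (Ne.symm hdu) (Ne.symm hdv)
        _ _ (Ne.symm hne) ?_ ?_ ?_ ?_ ?_ ?_ <;> clear Q hs <;> grind
    · refine ⟨u, hu, f s(u, v), f s(v, w), hne, ?_⟩
      refine star_of_quad K (fun a b => f s(a, b)) hs Q u v w d hu hv hw hd
        huv huw (Ne.symm hdu) hvw (Ne.symm hdv) (Ne.symm hdw)
        _ _ hne ?_ ?_ ?_ ?_ ?_ ?_ <;> clear Q hs <;> grind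
end
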